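/- Let A = kQ/I be a (locally) gentle algebra. The following are equivalent: (1) A satisfies (CM1), i.e., GKdim(A) = depth(A); (2) A satisfies (CM2), i.e., there exist commuting, homogeneous, algebraically independent elements x_1,…,x_d ∈ A with d = GKdim(A) such that A is a finitely generated free k[x_1,…,x_d]-module; (3) A has no finite maximal paths or A has no infinite maximal paths. -/

import Mathlib

/- Common framework for (locally) gentle algebras -/

noncomputable section
open scoped BigOperators
open CategoryTheory

namespace LocGentle

/-- A finite connected quiver with at least one vertex and one arrow. -/
structure Quiv where
  V : Type
  Arr : Type
  [fintypeV : Fintype V]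
  [fintypeA : Fintype Arr]
  [decEqV : DecidableEq V]
  [decEqA : DecidableEq Arr]
  src : Arr → V
  tgt : Arr → V
  [nonemptyV : Nonempty V]
  [nonemptyA : Nonempty Arr]
  connected : (SimpleGraph.fromRel (fun v w => ∃ a, src a = v ∧ tgt a = w)).Connected

attribute [instance] Quiv.fintypeV Quiv.fintypeA Quiv.decEqV Quiv.decEqA
  Quiv.nonemptyV Quiv.nonemptyA

variable (Q : Quiv)

/-- in-degree of a vertex -/
def indeg (v : Q.V) : ℕ := (Finset.univ.filter (fun a => Q.tgt a = v)).card

/-- out-degree of a vertex -/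
def outdeg (v : Q.V) : ℕ := (Finset.univ.filter (fun a => Q.src a = v)).card

/-- a list of arrows is composable (forms a path) -/
def Composable (l : List Q.Arr) : Prop := l.Chain' (fun a b => Q.tgt a = Q.src b)

variable {Q}

/-- source vertex of a nonempty word -/
def wSrc? (l : List Q.Arr) : Option Q.V := l.head?.map Q.src

/-- target vertex of a nonempty word -/
def wTgt? (l : List Q.Arr) : Option Q.V := l.getLast?.map Q.tgt

/-- target of a word, with a default value (used for stationary paths) -/
def wTgtD (l : List Q.Arr) (v : Q.V) : Q.V := (l.getLast?.map Q.tgt).getD v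

/-- last arrow of a word, with a (junk) default -/
def wLast (l : List Q.Arr) : Q.Arr := l.getLast?.getD (Classical.arbitrary _)

variable (rel : Q.Arr → Q.Arr → Prop)

/-- A word is allowed (is a basis path of `A = kQ/I`) if consecutive arrows are
composable and no consecutive pair lies in the relation set generating `I`. -/
def AllowedWord (l : List Q.Arr) : Prop :=
  l.Chain' (fun a b => Q.tgt a = Q.src b ∧ ¬ rel a b)

/-- right maximal paths (of positive length) -/
def RightMaxWord (l : List Q.Arr) : Prop :=
  l ≠ [] ∧ AllowedWord rel l ∧ ∀ a : Q.Arr, ¬ AllowedWord rel (l ++ [a])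

/-- left maximal paths (of positive length) -/
def LeftMaxWord (l : List Q.Arr) : Prop :=
  l ≠ [] ∧ AllowedWord rel l ∧ ∀ a : Q.Arr, ¬ AllowedWord rel (a :: l)

/-- finite maximal paths -/
def FiniteMaxWord (l : List Q.Arr) : Prop := RightMaxWord rel l ∧ LeftMaxWord rel l

/-- a word is primitive if it is not a proper power -/
def PrimitiveWord (l : List Q.Arr) : Prop :=
  ∀ (l' : List Q.Arr) (n : ℕ), 2 ≤ n → l ≠ (List.replicate n l').flatten

/-- a primitive cycle `c` with `c² ∉ I`; these represent the infinite maximal paths `c^∞`. -/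
def PrimCycleSq (c : List Q.Arr) : Prop :=
  c ≠ [] ∧ AllowedWord rel (c ++ c) ∧ wTgt? c = wSrc? c ∧ PrimitiveWord c

/-- the maximal path `γ_α` containing `α` is infinite -/
def InfThrough (a : Q.Arr) : Prop := ∃ c, PrimCycleSq rel c ∧ a ∈ c

/-- the maximal path `γ_α` containing `α` is finite -/
def FinThrough (a : Q.Arr) : Prop := ∃ l, FiniteMaxWord rel l ∧ a ∈ l

/-- the rotation of the cycle `c` starting at the arrow `a`; when `a ∈ c` and `c` has no
duplicates this is the primitive cycle `γ_r(a)`. -/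
def rotTo (c : List Q.Arr) (a : Q.Arr) : List Q.Arr :=
  c.dropWhile (fun b => b != a) ++ c.takeWhile (fun b => b != a)

/-- the relation set of the Koszul dual `A#`; its allowed words are the forbidden paths of `A`. -/
def dualRel : Q.Arr → Q.Arr → Prop := fun a b => Q.tgt a = Q.src b ∧ ¬ rel a b

/-- a forbidden path of `A`, i.e. a path of the Koszul dual `A#` -/
def ForbiddenWord (l : List Q.Arr) : Prop := AllowedWord (dualRel rel) l

variable (Q)

/-- The defining conditions (i)-(iv) of a (locally) gentle algebra, in terms of the set of
length-two relations generating the ideal `I`: an algebra satisfying them is gentle if it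
is finite dimensional and locally gentle otherwise. -/
structure IsGentleRel : Prop where
  indeg_le : ∀ v : Q.V, indeg Q v ≤ 2
  outdeg_le : ∀ v : Q.V, outdeg Q v ≤ 2
  rel_comp : ∀ a b : Q.Arr, rel a b → Q.tgt a = Q.src b
  cond_ii : ∀ a b b' : Q.Arr, b ≠ b' → Q.tgt b = Q.src a → Q.tgt b' = Q.src a →
    Xor' (rel b a) (rel b' a)
  cond_iii : ∀ a b b' : Q.Arr, b ≠ b' → Q.tgt a = Q.src b → Q.tgt a = Q.src b' →
    Xor' (rel a b) (rel a b')

/-- `Q` is (as a quiver) the extended Dynkin quiver `Ã_n` (for `n = |Q₀| - 1`):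
every vertex has in-degree and out-degree one. -/
def IsAtilde : Prop := ∀ v : Q.V, indeg Q v = 1 ∧ outdeg Q v = 1

/-- paths of `Q`, including the stationary paths (`w = []`) at each vertex -/
structure Pth where
  s : Q.V
  w : List Q.Arr
  hs : ∀ a ∈ w.head?, Q.src a = s
  hc : Composable Q w

variable {Q}

/-- target of a path -/
def Pth.t (p : Pth Q) : Q.V := wTgtD p.w p.s

/-- length of a path -/
def Pth.len (p : Pth Q) : ℕ := p.w.length

/-- a basis path of `A = kQ/I` -/
def Pth.Allowed (p : Pth Q) : Prop := AllowedWord rel p.w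

end LocGentle
namespace LocGentle

variable (k : Type) [Field k] (Q : Quiv) (rel : Q.Arr → Q.Arr → Prop)

/-- The defining relations presenting `A = kQ/I` as a quotient of the free algebra on
the stationary paths (vertices) and arrows: the path algebra relations together with
the relations `αβ = 0` for the length-two paths `αβ` generating `I`. -/
inductive GARel : FreeAlgebra k (Q.V ⊕ Q.Arr) → FreeAlgebra k (Q.V ⊕ Q.Arr) → Prop
  | idem (v : Q.V) : GARel (FreeAlgebra.ι k (Sum.inl v) * FreeAlgebra.ι k (Sum.inl v))
      (FreeAlgebra.ι k (Sum.inl v))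
  | orth (v w : Q.V) : v ≠ w → GARel (FreeAlgebra.ι k (Sum.inl v) * FreeAlgebra.ι k (Sum.inl w)) 0
  | unit : GARel (∑ v : Q.V, FreeAlgebra.ι k (Sum.inl v)) 1
  | src_mul (a : Q.Arr) : GARel (FreeAlgebra.ι k (Sum.inl (Q.src a)) * FreeAlgebra.ι k (Sum.inr a))
      (FreeAlgebra.ι k (Sum.inr a))
  | mul_tgt (a : Q.Arr) : GARel (FreeAlgebra.ι k (Sum.inr a) * FreeAlgebra.ι k (Sum.inl (Q.tgt a)))
      (FreeAlgebra.ι k (Sum.inr a))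
  | src_zero (v : Q.V) (a : Q.Arr) : v ≠ Q.src a →
      GARel (FreeAlgebra.ι k (Sum.inl v) * FreeAlgebra.ι k (Sum.inr a)) 0
  | tgt_zero (v : Q.V) (a : Q.Arr) : v ≠ Q.tgt a →
      GARel (FreeAlgebra.ι k (Sum.inr a) * FreeAlgebra.ι k (Sum.inl v)) 0
  | rel_zero (a b : Q.Arr) : rel a b →
      GARel (FreeAlgebra.ι k (Sum.inr a) * FreeAlgebra.ι k (Sum.inr b)) 0

/-- The (locally) gentle algebra `A = kQ/I`. -/
abbrev GA := RingQuot (GARel k Q rel)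

/-- the image in `A` of the stationary path at `v` -/
def vtx (v : Q.V) : GA k Q rel := RingQuot.mkAlgHom k _ (FreeAlgebra.ι k (Sum.inl v))

/-- the image in `A` of the arrow `a` -/
def arr (a : Q.Arr) : GA k Q rel := RingQuot.mkAlgHom k _ (FreeAlgebra.ι k (Sum.inr a))

/-- the image in `A` of the word `l` (the product of its arrows) -/
def wordEl (l : List Q.Arr) : GA k Q rel := (l.map (arr k Q rel)).prod

variable {Q}

/-- the image in `A` of a path (a stationary path maps to the corresponding idempotent) -/
def Pth.el (p : Pth Q) : GA k Q rel := vtx k Q rel p.s * wordEl k Q rel p.w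

variable (Q)

/-- the `n`-th graded component `A_n` of `A`, spanned by the images of paths of length `n` -/
def deg (n : ℕ) : Submodule k (GA k Q rel) :=
  Submodule.span k {x | ∃ p : Pth Q, p.Allowed rel ∧ p.len = n ∧ x = p.el k rel}

/-- the augmentation ideal `A₊` (as a `k`-submodule), spanned by paths of positive length -/
def degPlus : Submodule k (GA k Q rel) :=
  Submodule.span k {x | ∃ p : Pth Q, p.Allowed rel ∧ 1 ≤ p.len ∧ x = p.el k rel}

/-- the Hilbert series of `A` (with integer coefficients) -/
def hilb : PowerSeries ℤ :=
  PowerSeries.mk fun n => (Module.finrank k (deg k Q rel n) : ℤ)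

/-- the Hilbert series of `A` (with rational coefficients) -/
def hilbQ : PowerSeries ℚ :=
  PowerSeries.mk fun n => (Module.finrank k (deg k Q rel n) : ℚ)

/-- the number `k_n` of finite maximal paths of length at least `n` -/
def numFMP (n : ℕ) : ℕ := {l : List Q.Arr | FiniteMaxWord rel l ∧ n ≤ l.length}.ncard

/-- the Gelfand-Kirillov dimension of `A`:
`limsup_n log (dim_k A_{≤ n}) / log n`. -/
def GKdim : ℝ :=
  Filter.limsup (fun n : ℕ =>
      Real.log (Module.finrank k ↥(⨆ i ∈ Finset.range (n + 1), deg k Q rel i)) / Real.log n)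
    Filter.atTop

/-- the central element `m_γ` attached to the infinite maximal path `γ = c^∞`:
the sum over the arrows `α` of `c` of the primitive cycle `γ_r(α)` starting at `α`. -/
def mEl (c : List Q.Arr) : GA k Q rel := (c.map fun a => wordEl k Q rel (rotTo c a)).sum

/-- evaluation of a polynomial at `x ∈ A`; `polyEval k Q rel p x` is `p(x)`. -/
def polyEval (p : Polynomial k) (x : GA k Q rel) : GA k Q rel :=
  Polynomial.eval₂ (algebraMap k (GA k Q rel)) x p

end LocGentle
namespace LocGentle

variable (k : Type) [Field k] (Q : Quiv) (rel : Q.Arr → Q.Arr → Prop)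

/-! ### Two-sided ideals and primes -/

/-- a prime (two-sided) ideal -/
def IsPrimeTI (P : TwoSidedIdeal (GA k Q rel)) : Prop :=
  P ≠ ⊤ ∧ ∀ x y : GA k Q rel, (∀ a : GA k Q rel, x * a * y ∈ P) → x ∈ P ∨ y ∈ P

/-- the maximal ideal `𝔪_v` of `A` which does not contain `ε_v`: it is generated by the
stationary paths at the other vertices together with all loops at `v`. -/
def mIdeal (v : Q.V) : TwoSidedIdeal (GA k Q rel) :=
  TwoSidedIdeal.span
    ({x | ∃ w : Q.V, w ≠ v ∧ x = vtx k Q rel w} ∪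
     {x | ∃ a : Q.Arr, Q.src a = v ∧ Q.tgt a = v ∧ x = arr k Q rel a})

/-- the ideal `J_γ` corresponding to the infinite maximal path `γ = c^∞`, generated by
all arrows lying on `γ` -/
def Jgamma (c : List Q.Arr) : TwoSidedIdeal (GA k Q rel) :=
  TwoSidedIdeal.span {x | ∃ a ∈ c, x = arr k Q rel a}

/-- the left annihilator of `J_γ` -/
def annJ (c : List Q.Arr) : Set (GA k Q rel) :=
  {x | ∀ y ∈ Jgamma k Q rel c, x * y = 0}

/-! ### The simple modules `S(v)`, and `Ext` groups -/

/-- the algebra map `A → k` corresponding to the vertex `v` (projection onto the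
coefficient of `ε_v`) -/
def vtxHomAux (v : Q.V) : FreeAlgebra k (Q.V ⊕ Q.Arr) →ₐ[k] k :=
  FreeAlgebra.lift k (Sum.elim (fun w => if w = v then (1 : k) else 0) (fun _ => 0))

theorem vtxHomAux_rel (v : Q.V) : ∀ ⦃x y⦄, GARel k Q rel x y →
    vtxHomAux k Q v x = vtxHomAux k Q v y := by
  intro x y h
  cases h with
  | idem w =>
      simp only [vtxHomAux, map_mul, FreeAlgebra.lift_ι_apply, Sum.elim_inl]
      split_ifs <;> simp
  | orth w w' hne =>
      simp only [vtxHomAux, map_mul, FreeAlgebra.lift_ι_apply, Sum.elim_inl, map_zero]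
      split_ifs with h1 h2 <;> first | (exact absurd (h1.trans h2.symm) hne) | simp
  | unit =>
      simp only [vtxHomAux, map_sum, FreeAlgebra.lift_ι_apply, Sum.elim_inl, map_one]
      simp [Finset.sum_ite_eq' Finset.univ v (fun _ => (1:k))]
  | src_mul a =>
      simp [vtxHomAux, map_mul, FreeAlgebra.lift_ι_apply]
  | mul_tgt a =>
      simp [vtxHomAux, map_mul, FreeAlgebra.lift_ι_apply]
  | src_zero w a hw =>
      simp [vtxHomAux, map_mul, FreeAlgebra.lift_ι_apply]
  | tgt_zero w a hw =>
      simp [vtxHomAux, map_mul, FreeAlgebra.lift_ι_apply]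
  | rel_zero a b hab =>
      simp [vtxHomAux, map_mul, FreeAlgebra.lift_ι_apply]

/-- the ring map `A → k` corresponding to the vertex `v` -/
def vtxHom (v : Q.V) : GA k Q rel →+* k :=
  RingQuot.lift ⟨(vtxHomAux k Q v).toRingHom, fun _ _ h => vtxHomAux_rel k Q rel v h⟩

/-- the ring map `A → k^{Q₀}` with kernel `A₊` -/
def SHom : GA k Q rel →+* (Q.V → k) := Pi.ringHom fun v => vtxHom k Q rel v

/-- the graded simple right `A`-module `S(v)` at the vertex `v` -/
def SvModR (v : Q.V) : ModuleCat (GA k Q rel)ᵐᵒᵖ :=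
  @ModuleCat.of _ _ k _
    (Module.compHom k ((vtxHom k Q rel v).fromOpposite (fun _ _ => mul_comm _ _)))

/-- the graded simple left `A`-module `S(v)` at the vertex `v` -/
def SvModL (v : Q.V) : ModuleCat (GA k Q rel) :=
  @ModuleCat.of _ _ k _ (Module.compHom k (vtxHom k Q rel v))

/-- `S = A/A₊ ≅ ⊕_v S(v)` as a right `A`-module -/
def SModR : ModuleCat (GA k Q rel)ᵐᵒᵖ :=
  @ModuleCat.of _ _ (Q.V → k) _
    (Module.compHom _ ((SHom k Q rel).fromOpposite (fun _ _ => mul_comm _ _)))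

/-- `S = A/A₊` as a left `A`-module -/
def SModL : ModuleCat (GA k Q rel) :=
  @ModuleCat.of _ _ (Q.V → k) _ (Module.compHom _ (SHom k Q rel))

/-- `A` as a right module over itself -/
def AModR : ModuleCat (GA k Q rel)ᵐᵒᵖ := ModuleCat.of _ (GA k Q rel)

/-- `A` as a left module over itself -/
def AModL : ModuleCat (GA k Q rel) := ModuleCat.of _ (GA k Q rel)

/-- nonvanishing of `Ext^i(M, N)` for modules over a ring `R` -/
def extNZ {R : Type} [Ring R] (i : ℕ) (M N : ModuleCat R) : Prop :=
  ¬ Subsingleton (((Ext ℤ (ModuleCat R) i).obj (Opposite.op M)).obj N)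

/-- nonvanishing of `Ext^i_A(S(v), A)` in right `A`-modules.  (For the Noetherian graded
algebra `A` with the finitely generated modules `S(v)` and `A` this agrees with the graded
`Ext`-group, summed over all shifts, used in the paper.) -/
def extSvNZ (i : ℕ) (v : Q.V) : Prop := extNZ i (SvModR k Q rel v) (AModR k Q rel)

/-- nonvanishing of `Ext^i_A(S, A)` in right `A`-modules -/
def extSNZ (i : ℕ) : Prop := extNZ i (SModR k Q rel) (AModR k Q rel)

/-- the depth of `A`: `min { i : Ext^i_A(S, A) ≠ 0 }` -/
def depth : ℕ∞ := sInf {n : ℕ∞ | ∃ i : ℕ, n = i ∧ extSNZ k Q rel i}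

/-- the right self-injective dimension of `A`:
`sup { i : Ext^i(M, A) ≠ 0 for some right module M }` -/
def rInjDim : ℕ∞ :=
  sSup {n : ℕ∞ | ∃ (i : ℕ) (M : ModuleCat.{0} (GA k Q rel)ᵐᵒᵖ), n = i ∧ extNZ i M (AModR k Q rel)}

/-- the left self-injective dimension of `A` -/
def lInjDim : ℕ∞ :=
  sSup {n : ℕ∞ | ∃ (i : ℕ) (M : ModuleCat.{0} (GA k Q rel)), n = i ∧ extNZ i M (AModL k Q rel)}

/-- the right global dimension of `A`: `sup { i : Ext^i(M, N) ≠ 0 }` over right modules -/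
def rGlDim : ℕ∞ :=
  sSup {n : ℕ∞ | ∃ (i : ℕ) (M N : ModuleCat.{0} (GA k Q rel)ᵐᵒᵖ), n = i ∧ extNZ i M N}

/-- the left global dimension of `A` -/
def lGlDim : ℕ∞ :=
  sSup {n : ℕ∞ | ∃ (i : ℕ) (M N : ModuleCat.{0} (GA k Q rel)), n = i ∧ extNZ i M N}

end LocGentle
namespace LocGentle

variable (k : Type) [Field k] (Q : Quiv) (rel : Q.Arr → Q.Arr → Prop)

/-- the condition (CM1): `GKdim A = depth A` -/
def SatCM1 : Prop :=
  ∃ d : ℕ, GKdim k Q rel = (d : ℝ) ∧ depth k Q rel = (d : ℕ∞)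

/-- the condition (CM2): there are commuting, homogeneous, algebraically independent
elements `x₁, …, x_d ∈ A` with `d = GKdim A` such that `A` is a finitely generated free
module over the polynomial subalgebra `k[x₁, …, x_d]`.  (Algebraic independence of the
commuting family `x` is expressed by the `k`-linear independence of the monomials in the
`xᵢ`.) -/
def SatCM2 : Prop :=
  ∃ (d : ℕ) (x : Fin d → GA k Q rel),
    GKdim k Q rel = (d : ℝ) ∧
    (∀ i j : Fin d, Commute (x i) (x j)) ∧
    (∀ i : Fin d, ∃ n : ℕ, x i ∈ deg k Q rel n) ∧
    LinearIndependent k (fun m : (Fin d →₀ ℕ) => (((List.finRange d).map fun i => x i ^ m i)).prod) ∧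
    Module.Free ↥(Algebra.adjoin k (Set.range x)) (GA k Q rel) ∧
    Module.Finite ↥(Algebra.adjoin k (Set.range x)) (GA k Q rel)

/-- the sum of all arrows of `Q` -/
def arrSum : GA k Q rel := ∑ a : Q.Arr, arr k Q rel a

end LocGentle
namespace LocGentle

section ExtCriteria

variable {R : Type} [Ring R] {M N : ModuleCat.{0} R}

theorem not_extNZ_iff (P : ProjectiveResolution M) (i : ℕ) :
    ¬ extNZ i M N ↔ (P.complex.linearYonedaObj ℤ N).ExactAt i := by
  unfold extNZ
  rw [not_not, HomologicalComplex.exactAt_iff_isZero_homology,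
    ← ModuleCat.isZero_iff_subsingleton]
  exact (P.isoExt i N).isZero_iff

/-- The beginning of a projective resolution, as an augmentation that is a cokernel of the
first differential. -/
theorem exists_augmentation (P : ProjectiveResolution M) :
    ∃ e : P.complex.X 0 ⟶ M, Epi e ∧ P.complex.d 1 0 ≫ e = 0 ∧
      ∀ {L : ModuleCat.{0} R} (g : P.complex.X 0 ⟶ L), P.complex.d 1 0 ≫ g = 0 →
        ∃ l : M ⟶ L, e ≫ l = g := by
  refine ⟨P.π.f 0, inferInstanceAs (Epi (P.π.f 0)), P.complex_d_comp_π_f_zero, ?_⟩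
  intro L g hg
  exact P.exact₀.desc' g hg

/-- A nonzero morphism `M ⟶ N` gives a nonzero class in `Ext⁰(M, N)`. -/
theorem extNZ_zero_of_hom (f : M ⟶ N) (hf : f ≠ 0) : extNZ 0 M N := by
  let P := projectiveResolution M
  obtain ⟨e, he, hde, -⟩ := exists_augmentation P
  by_contra h
  rw [not_extNZ_iff P, HomologicalComplex.exactAt_iff' _ 0 0 1 (by simp) (by simp),
    ShortComplex.moduleCat_exact_iff] at h
  obtain ⟨y, hy⟩ := h (e ≫ f) (by
    change P.complex.d 1 0 ≫ e ≫ f = 0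
    rw [← Category.assoc, hde, Limits.zero_comp])
  apply hf
  rw [← cancel_epi e, Limits.comp_zero, ← hy]
  change P.complex.d 0 0 ≫ y = 0
  rw [P.complex.shape 0 0 (by simp)]
  exact Limits.zero_comp

/-- If there is no nonzero morphism `M ⟶ N` then `Ext⁰(M, N)` vanishes. -/
theorem not_extNZ_zero (h : ∀ f : M ⟶ N, f = 0) : ¬ extNZ 0 M N := by
  let P := projectiveResolution M
  obtain ⟨e, -, -, hdesc⟩ := exists_augmentation P
  rw [not_extNZ_iff P, HomologicalComplex.exactAt_iff' _ 0 0 1 (by simp) (by simp),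
    ShortComplex.moduleCat_exact_iff]
  intro x hx
  refine ⟨0, ?_⟩
  change P.complex.X 0 ⟶ N at x
  obtain ⟨l, hl⟩ := hdesc x hx
  rw [map_zero, ← hl, h l]
  exact Limits.comp_zero.symm

/-- If `Hom(M, N) = 0` and `x` is an injective endomorphism of `N` such that there is a nonzero
morphism from `M` to its cokernel, then `Ext¹(M, N)` does not vanish. -/
theorem extNZ_one {L : ModuleCat.{0} R} (h : ∀ f : M ⟶ N, f = 0) (x : N ⟶ N) [Mono x]
    (p : N ⟶ L) [Epi p] (w : x ≫ p = 0) (hex : (ShortComplex.mk x p w).Exact)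
    (f : M ⟶ L) (hf : f ≠ 0) : extNZ 1 M N := by
  let P := projectiveResolution M
  obtain ⟨e, he, hde, hdesc⟩ := exists_augmentation P
  by_contra hn
  rw [not_extNZ_iff P, HomologicalComplex.exactAt_iff' _ 0 1 2 (by simp) (by simp),
    ShortComplex.moduleCat_exact_iff] at hn
  let g : P.complex.X 0 ⟶ N := Projective.factorThru (e ≫ f) p
  have hg : g ≫ p = e ≫ f := Projective.factorThru_comp _ _
  let u : P.complex.X 1 ⟶ N := hex.lift (P.complex.d 1 0 ≫ g) (by
    change (P.complex.d 1 0 ≫ g) ≫ p = 0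
    rw [Category.assoc, hg, ← Category.assoc, hde, Limits.zero_comp])
  have hu : u ≫ x = P.complex.d 1 0 ≫ g := hex.lift_f _ _
  obtain ⟨y, hy⟩ := hn u (by
    change P.complex.d 2 1 ≫ u = 0
    rw [← cancel_mono x, Category.assoc, hu]
    simp)
  change P.complex.X 0 ⟶ N at y
  replace hy : P.complex.d 1 0 ≫ y = u := hy
  obtain ⟨l, hl⟩ := hdesc (g - y ≫ x) (by
    rw [Preadditive.comp_sub, ← Category.assoc, hy, hu, sub_self])
  have hgy : g = y ≫ x := by
    rw [← sub_eq_zero, ← hl, h l, Limits.comp_zero]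
  apply hf
  rw [← cancel_epi e, ← hg, hgy, Category.assoc, w, Limits.comp_zero, Limits.comp_zero]

end ExtCriteria

section Words

/-- In a deterministic relation, a chain ending in an element without successor has no
repetition. -/
theorem nodup_of_isChain_of_forall_not {α : Type*} {r : α → α → Prop}
    (hr : ∀ a b b', r a b → r a b' → b = b') {a : α} (ha : ∀ b, ¬ r a b) (l : List α)
    (h : List.IsChain r (l ++ [a])) : (l ++ [a]).Nodup := by
  induction l with
  | nil => simp
  | cons x l ih =>
    rw [List.cons_append, List.isChain_cons] at h
    obtain ⟨hx, hl⟩ := h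
    have hnd := ih hl
    rw [List.cons_append, List.nodup_cons]
    refine ⟨fun hmem => ?_, hnd⟩
    obtain ⟨u, w, huw⟩ := List.append_of_mem hmem
    rw [huw] at hx hl hnd
    cases w with
    | nil =>
      have hxa : x = a := by
        have := congrArg List.getLast? huw
        simpa using this.symm
      cases u with
      | nil => exact ha x (hxa ▸ hx x (by simp))
      | cons z u => exact ha z (hxa ▸ hx z (by simp))
    | cons y w =>
      have hxy : r x y := (List.isChain_cons_cons.1 (List.isChain_append.1 hl).2.1).1
      cases u with
      | nil =>
        have := hr _ _ _ hxy (hx x (by simp))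
        simp [this] at hnd
      | cons z u =>
        have := hr _ _ _ hxy (hx z (by simp))
        simp [this] at hnd

/-- A chain with a repetition yields a chain `c ++ c`. -/
theorem exists_isChain_append_self_of_not_nodup {α : Type*} {r : α → α → Prop} (l : List α)
    (h : List.IsChain r l) (hl : ¬ l.Nodup) : ∃ c : List α, c ≠ [] ∧ List.IsChain r (c ++ c) := by
  induction l with
  | nil => simp at hl
  | cons x l ih =>
    by_cases hx : x ∈ l
    · obtain ⟨s, t, rfl⟩ := List.append_of_mem hx
      refine ⟨x :: s, by simp, ?_⟩
      have h' : List.IsChain r ((x :: s) ++ x :: t) := by simpa using h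
      rw [List.isChain_append] at h' ⊢
      refine ⟨h'.1, h'.1, ?_⟩
      simpa using h'.2.2
    · refine ih (List.isChain_cons.1 h).2 fun hnd => hl (List.nodup_cons.2 ⟨hx, hnd⟩)

theorem isChain_flatten_replicate {α : Type*} {r : α → α → Prop} {c : List α} (hc : c ≠ [])
    (h : List.IsChain r (c ++ c)) (n : ℕ) : List.IsChain r (List.replicate n c).flatten := by
  induction n with
  | zero => simp
  | succ n ih =>
    rw [List.replicate_succ, List.flatten_cons]
    rw [List.isChain_append] at h ⊢
    refine ⟨h.1, ih, ?_⟩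
    cases n with
    | zero => simp
    | succ n =>
      rw [List.replicate_succ, List.flatten_cons, List.head?_append_of_ne_nil _ hc]
      exact h.2.2

variable {Q : Quiv} {rel : Q.Arr → Q.Arr → Prop}

/-- `b` may follow `a` in a path of `A`. -/
def Follows (rel : Q.Arr → Q.Arr → Prop) (a b : Q.Arr) : Prop := Q.tgt a = Q.src b ∧ ¬ rel a b

theorem allowedWord_iff (l : List Q.Arr) : AllowedWord rel l ↔ List.IsChain (Follows rel) l :=
  Iff.rfl

theorem Follows.right_unique (h : IsGentleRel Q rel) (a b b' : Q.Arr) (hb : Follows rel a b)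
    (hb' : Follows rel a b') : b = b' := by
  by_contra hne
  rcases h.cond_iii a b b' hne hb.1 hb'.1 with h1 | h1
  · exact hb.2 h1.1
  · exact hb'.2 h1.1

theorem Follows.left_unique (h : IsGentleRel Q rel) (a a' b : Q.Arr) (hb : Follows rel a b)
    (hb' : Follows rel a' b) : a = a' := by
  by_contra hne
  rcases h.cond_ii b a a' hne hb.1 hb'.1 with h1 | h1
  · exact hb.2 h1.1
  · exact hb'.2 h1.1

/-- Without finite maximal paths every arrow can be prolonged. -/
theorem exists_follows (h : IsGentleRel Q rel) (hf : ¬ ∃ l : List Q.Arr, FiniteMaxWord rel l)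
    (a : Q.Arr) : ∃ b, Follows rel a b := by
  by_contra! ha
  have key : ∀ n : ℕ, ∃ l : List Q.Arr, l.length = n ∧ List.IsChain (Follows rel) (l ++ [a]) := by
    intro n
    induction n with
    | zero => exact ⟨[], by simp⟩
    | succ n ih =>
      obtain ⟨l, hl, hc⟩ := ih
      by_contra! hno
      refine hf ⟨l ++ [a], ⟨by simp, hc, fun b hb => ?_⟩, by simp, hc, fun b hb => ?_⟩
      · rw [allowedWord_iff, List.isChain_append] at hb
        exact ha b (hb.2.2 a (by simp) b (by simp))
      · exact hno (b :: l) (by simp [hl]) hb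
  obtain ⟨l, hl, hc⟩ := key (Fintype.card Q.Arr)
  have := (nodup_of_isChain_of_forall_not (Follows.right_unique h) ha l hc).length_le_card
  simp [hl] at this

/-- Without finite maximal paths the prolongation of arrows is a permutation. -/
theorem exists_perm (h : IsGentleRel Q rel) (hf : ¬ ∃ l : List Q.Arr, FiniteMaxWord rel l) :
    ∃ σ : Equiv.Perm Q.Arr, ∀ a b, Follows rel a b ↔ b = σ a := by
  choose s hs using exists_follows h hf
  have hinj : Function.Injective s := fun a a' haa =>
    Follows.left_unique h a a' (s a) (hs a) (haa ▸ hs a')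
  refine ⟨Equiv.ofBijective s (Finite.injective_iff_bijective.1 hinj), fun a b => ⟨fun hab => ?_, ?_⟩⟩
  · exact Follows.right_unique h _ _ _ hab (hs a)
  · rintro rfl
    exact hs a

theorem exists_primCycleSq_iff :
    (∃ c : List Q.Arr, PrimCycleSq rel c) ↔
      ∃ c : List Q.Arr, c ≠ [] ∧ List.IsChain (Follows rel) (c ++ c) := by
  constructor
  · rintro ⟨c, hc, hcc, -⟩
    exact ⟨c, hc, hcc⟩
  · rintro ⟨c, hc, hcc⟩
    induction hn : c.length using Nat.strong_induction_on generalizing c with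
    | _ n ih =>
      by_cases hp : PrimitiveWord c
      · refine ⟨c, hc, hcc, ?_, hp⟩
        have := (List.isChain_append.1 hcc).2.2 (c.getLast hc) (by simp [List.getLast?_eq_some_getLast hc])
          (c.head hc) (by simp [List.head?_eq_some_head hc])
        simp [wTgt?, wSrc?, List.getLast?_eq_some_getLast hc, List.head?_eq_some_head hc, this.1]
      · simp only [PrimitiveWord, not_forall, not_not] at hp
        obtain ⟨d, m, hm, rfl⟩ := hp
        have hd : d ≠ [] := by
          rintro rfl
          simp at hc
        have hlen : 0 < d.length := List.length_pos_iff.2 hd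
        refine ih d.length ?_ d hd ?_ rfl
        · rw [← hn]
          simp only [List.length_flatten, List.map_replicate, List.sum_replicate, smul_eq_mul]
          nlinarith
        · obtain ⟨j, rfl⟩ := Nat.exists_eq_add_of_le hm
          rw [add_comm, List.replicate_succ, List.replicate_succ, List.flatten_cons,
            List.flatten_cons] at hcc
          have := (List.isChain_append.1 hcc).1
          rw [← List.append_assoc] at this
          exact (List.isChain_append.1 this).1

/-- An infinite maximal path gives basis paths of every length. -/
theorem exists_allowedWord_length (h : ∃ c : List Q.Arr, PrimCycleSq rel c) (n : ℕ) :
    ∃ l : List Q.Arr, AllowedWord rel l ∧ l.length = n := by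
  obtain ⟨c, hc, hcc⟩ := exists_primCycleSq_iff.1 h
  refine ⟨(List.replicate n c).flatten.take n, (isChain_flatten_replicate hc hcc n).take n, ?_⟩
  have hlen : 0 < c.length := List.length_pos_iff.2 hc
  simp only [List.length_take, List.length_flatten, List.map_replicate, List.sum_replicate,
    smul_eq_mul]
  exact min_eq_left (by nlinarith)

/-- Without infinite maximal paths the basis paths have bounded length. -/
theorem length_le_card_of_allowedWord (h : ¬ ∃ c : List Q.Arr, PrimCycleSq rel c)
    (l : List Q.Arr) (hl : AllowedWord rel l) : l.length ≤ Fintype.card Q.Arr := by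
  by_contra hlt
  refine h (exists_primCycleSq_iff.2 (exists_isChain_append_self_of_not_nodup l hl fun hnd => ?_))
  exact hlt hnd.length_le_card

/-- If there is no finite maximal path there is an infinite one. -/
theorem exists_primCycleSq (hg : IsGentleRel Q rel)
    (hf : ¬ ∃ l : List Q.Arr, FiniteMaxWord rel l) : ∃ c : List Q.Arr, PrimCycleSq rel c := by
  by_contra hc
  have key : ∀ n : ℕ, ∃ l : List Q.Arr, l.length = n ∧ AllowedWord rel l := by
    intro n
    induction n with
    | zero => exact ⟨[], by simp [allowedWord_iff]⟩
    | succ n ih =>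
      obtain ⟨l, hl, hlc⟩ := ih
      rcases l.eq_nil_or_concat' with rfl | ⟨l', a, rfl⟩
      · exact ⟨[Classical.arbitrary _], by simpa using hl.symm, by simp [allowedWord_iff]⟩
      · obtain ⟨b, hb⟩ := exists_follows hg hf a
        refine ⟨l' ++ [a] ++ [b], by simpa using hl, ?_⟩
        rw [allowedWord_iff, List.isChain_append]
        exact ⟨hlc, by simp, by simpa using hb⟩
  obtain ⟨l, hl, hlc⟩ := key (Fintype.card Q.Arr + 1)
  have := length_le_card_of_allowedWord hc l hlc
  omega

end Words

section Representation

variable (k : Type) [Field k] {Q : Quiv} (rel : Q.Arr → Q.Arr → Prop)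
  {Z : Type} (z : Z → Q.V)

/-- The vertex of a state: an arrow sits at its source, an additional state `t` at `z t`. -/
def stateVtx (z : Z → Q.V) : Q.Arr ⊕ Z → Q.V := Sum.elim Q.src z

/-- The states that may follow an arrow. -/
def NextState (a : Q.Arr) (j : Q.Arr ⊕ Z) : Prop :=
  Sum.elim (Follows rel a) (fun t => Q.tgt a = z t) j

theorem NextState.stateVtx_eq {rel : Q.Arr → Q.Arr → Prop} {z : Z → Q.V} {a : Q.Arr}
    {j : Q.Arr ⊕ Z} (h : NextState rel z a j) : stateVtx z j = Q.tgt a := by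
  rcases j with b | t
  · exact h.1.symm
  · exact Eq.symm h

variable [Fintype Z] [DecidableEq Z]

open Classical in
/-- The matrix by which an arrow acts on states. -/
def arrMat (a : Q.Arr) : Matrix (Q.Arr ⊕ Z) (Q.Arr ⊕ Z) (Polynomial k) :=
  Matrix.of fun i j => if i = Sum.inl a ∧ NextState rel z a j then Polynomial.X else 0

/-- The matrix by which a stationary path acts on states. -/
def vtxMat (v : Q.V) : Matrix (Q.Arr ⊕ Z) (Q.Arr ⊕ Z) (Polynomial k) :=
  Matrix.diagonal fun j => if stateVtx z j = v then 1 else 0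

/-- The action of the free algebra on states. -/
def repAux : FreeAlgebra k (Q.V ⊕ Q.Arr) →ₐ[k]
    Matrix (Q.Arr ⊕ Z) (Q.Arr ⊕ Z) (Polynomial k) :=
  FreeAlgebra.lift k (Sum.elim (vtxMat k z) (arrMat k rel z))

theorem repAux_rel ⦃x y : FreeAlgebra k (Q.V ⊕ Q.Arr)⦄ (h : GARel k Q rel x y) :
    repAux k rel z x = repAux k rel z y := by
  cases h with
  | idem v =>
    simp only [repAux, map_mul, FreeAlgebra.lift_ι_apply, Sum.elim_inl, vtxMat,
      Matrix.diagonal_mul_diagonal]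
    congr 1
    ext1 j
    split_ifs <;> simp
  | orth v w hne =>
    simp only [repAux, map_mul, FreeAlgebra.lift_ι_apply, Sum.elim_inl, vtxMat,
      Matrix.diagonal_mul_diagonal, map_zero]
    rw [← Matrix.diagonal_zero]
    congr 1
    ext1 j
    split_ifs with h1 h2 <;> first | exact absurd (h1.symm.trans h2) hne | simp
  | unit =>
    simp only [repAux, map_sum, FreeAlgebra.lift_ι_apply, Sum.elim_inl, vtxMat, map_one]
    ext1 i j
    rw [Matrix.sum_apply]
    by_cases hij : i = j
    · subst hij
      simp
    · simp [hij]
  | src_mul a =>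
    simp only [repAux, map_mul, FreeAlgebra.lift_ι_apply, Sum.elim_inl, Sum.elim_inr, vtxMat]
    ext1 i j
    simp only [Matrix.diagonal_mul, arrMat, Matrix.of_apply]
    by_cases hi : i = Sum.inl a
    · subst hi
      simp [stateVtx]
    · simp [hi]
  | mul_tgt a =>
    simp only [repAux, map_mul, FreeAlgebra.lift_ι_apply, Sum.elim_inl, Sum.elim_inr, vtxMat]
    ext1 i j
    simp only [Matrix.mul_diagonal, arrMat, Matrix.of_apply]
    by_cases hj : NextState rel z a j
    · simp [hj.stateVtx_eq]
    · simp [hj]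
  | src_zero v a hv =>
    simp only [repAux, map_mul, FreeAlgebra.lift_ι_apply, Sum.elim_inl, Sum.elim_inr, vtxMat,
      map_zero]
    ext1 i j
    simp only [Matrix.diagonal_mul, arrMat, Matrix.of_apply]
    by_cases hi : i = Sum.inl a
    · subst hi
      simp [stateVtx, hv.symm]
    · simp [hi]
  | tgt_zero v a hv =>
    simp only [repAux, map_mul, FreeAlgebra.lift_ι_apply, Sum.elim_inl, Sum.elim_inr, vtxMat,
      map_zero]
    ext1 i j
    simp only [Matrix.mul_diagonal, arrMat, Matrix.of_apply]
    by_cases hj : NextState rel z a j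
    · simp [hj.stateVtx_eq, hv.symm]
    · simp [hj]
  | rel_zero a b hab =>
    simp only [repAux, map_mul, FreeAlgebra.lift_ι_apply, Sum.elim_inr, map_zero]
    ext1 i j
    rw [Matrix.mul_apply]
    refine Finset.sum_eq_zero fun l _ => ?_
    simp only [arrMat, Matrix.of_apply]
    by_cases hl : l = Sum.inl b
    · subst hl
      have : ¬ NextState rel z a (Sum.inl b) := fun hf => hf.2 hab
      simp [this]
    · simp [hl]

/-- The right action of `A` on states, with polynomial coefficients recording path length. -/
def rep : GA k Q rel →ₐ[k] Matrix (Q.Arr ⊕ Z) (Q.Arr ⊕ Z) (Polynomial k) :=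
  RingQuot.liftAlgHom k ⟨repAux k rel z, repAux_rel k rel z⟩

@[simp] theorem rep_vtx (v : Q.V) : rep k rel z (vtx k Q rel v) = vtxMat k z v := by
  simp [rep, vtx, repAux]

@[simp] theorem rep_arr (a : Q.Arr) : rep k rel z (arr k Q rel a) = arrMat k rel z a := by
  simp [rep, arr, repAux]

open Classical in
/-- The action of a basis path on states. -/
theorem rep_wordEl (l : List Q.Arr) (a : Q.Arr) (h : AllowedWord rel (a :: l))
    (i j : Q.Arr ⊕ Z) :
    rep k rel z (wordEl k Q rel (a :: l)) i j =
      if i = Sum.inl a ∧ NextState rel z ((a :: l).getLast (by simp)) j then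
        Polynomial.X ^ (l.length + 1) else 0 := by
  induction l generalizing a i with
  | nil => simp [wordEl, arrMat]
  | cons b l ih =>
    have hc := List.isChain_cons_cons.1 ((allowedWord_iff _).1 h)
    have hw : wordEl k Q rel (a :: b :: l) = arr k Q rel a * wordEl k Q rel (b :: l) := by
      simp [wordEl]
    rw [hw, map_mul, Matrix.mul_apply, Finset.sum_eq_single (Sum.inl b)]
    · rw [ih b hc.2, rep_arr]
      have hn : NextState rel z a (Sum.inl b) := hc.1
      by_cases hi : i = Sum.inl a
      · simp only [arrMat, Matrix.of_apply, hi, hn, List.getLast_cons_cons, true_and, if_true,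
          List.length_cons, and_true]
        split_ifs
        · rw [← pow_succ']
        · simp
      · simp [arrMat, hi]
    · intro s _ hs
      rw [ih b hc.2]
      simp [hs]
    · simp

end Representation

section Elements

variable {k : Type} [Field k] {Q : Quiv} {rel : Q.Arr → Q.Arr → Prop}

theorem wordEl_nil : wordEl k Q rel [] = 1 := by simp [wordEl]

theorem wordEl_cons (a : Q.Arr) (l : List Q.Arr) :
    wordEl k Q rel (a :: l) = arr k Q rel a * wordEl k Q rel l := by simp [wordEl]

theorem wordEl_append (l l' : List Q.Arr) :
    wordEl k Q rel (l ++ l') = wordEl k Q rel l * wordEl k Q rel l' := by simp [wordEl]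

theorem vtx_mul_vtx_self (v : Q.V) : vtx k Q rel v * vtx k Q rel v = vtx k Q rel v := by
  simpa [vtx] using RingQuot.mkAlgHom_rel k (GARel.idem (k := k) (rel := rel) v)

theorem vtx_mul_vtx_of_ne {v w : Q.V} (h : v ≠ w) : vtx k Q rel v * vtx k Q rel w = 0 := by
  simpa [vtx] using RingQuot.mkAlgHom_rel k (GARel.orth (k := k) (rel := rel) v w h)

theorem sum_vtx : ∑ v : Q.V, vtx k Q rel v = 1 := by
  simpa [vtx] using RingQuot.mkAlgHom_rel k (GARel.unit (k := k) (rel := rel))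

theorem vtx_mul_arr (a : Q.Arr) : vtx k Q rel (Q.src a) * arr k Q rel a = arr k Q rel a := by
  simpa [vtx, arr] using RingQuot.mkAlgHom_rel k (GARel.src_mul (k := k) (rel := rel) a)

theorem arr_mul_vtx (a : Q.Arr) : arr k Q rel a * vtx k Q rel (Q.tgt a) = arr k Q rel a := by
  simpa [vtx, arr] using RingQuot.mkAlgHom_rel k (GARel.mul_tgt (k := k) (rel := rel) a)

theorem vtx_mul_arr_of_ne {v : Q.V} {a : Q.Arr} (h : v ≠ Q.src a) :
    vtx k Q rel v * arr k Q rel a = 0 := by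
  simpa [vtx, arr] using RingQuot.mkAlgHom_rel k (GARel.src_zero (k := k) (rel := rel) v a h)

theorem arr_mul_vtx_of_ne {v : Q.V} {a : Q.Arr} (h : v ≠ Q.tgt a) :
    arr k Q rel a * vtx k Q rel v = 0 := by
  simpa [vtx, arr] using RingQuot.mkAlgHom_rel k (GARel.tgt_zero (k := k) (rel := rel) v a h)

theorem arr_mul_arr_of_not_follows {a b : Q.Arr} (h : ¬ Follows rel a b) :
    arr k Q rel a * arr k Q rel b = 0 := by
  by_cases hab : Q.tgt a = Q.src b
  · have hr : rel a b := by
      by_contra hr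
      exact h ⟨hab, hr⟩
    simpa [arr] using RingQuot.mkAlgHom_rel k (GARel.rel_zero (k := k) a b hr)
  · rw [← arr_mul_vtx, mul_assoc, vtx_mul_arr_of_ne hab, mul_zero]

/-- Induction principle: every element of `A` is obtained from scalars, stationary paths and
arrows by sums and products. -/
theorem GA.induction {C : GA k Q rel → Prop} (hs : ∀ c : k, C (algebraMap k _ c))
    (hv : ∀ v, C (vtx k Q rel v)) (ha : ∀ a, C (arr k Q rel a))
    (hadd : ∀ x y, C x → C y → C (x + y)) (hmul : ∀ x y, C x → C y → C (x * y))
    (x : GA k Q rel) : C x := by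
  obtain ⟨y, rfl⟩ := RingQuot.mkAlgHom_surjective k (GARel k Q rel) x
  induction y using FreeAlgebra.induction with
  | grade0 r => simpa using hs r
  | grade1 x =>
    rcases x with v | a
    · exact hv v
    · exact ha a
  | mul a b h1 h2 => simpa using hmul _ _ h1 h2
  | add a b h1 h2 => simpa using hadd _ _ h1 h2

end Elements

section Span

variable {k : Type} [Field k] {Q : Quiv} {rel : Q.Arr → Q.Arr → Prop}

theorem vtx_mul_wordEl_cons (a : Q.Arr) (l : List Q.Arr) :
    vtx k Q rel (Q.src a) * wordEl k Q rel (a :: l) = wordEl k Q rel (a :: l) := by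
  rw [wordEl_cons, ← mul_assoc, vtx_mul_arr]

theorem arr_mul_wordEl_cons_of_not_allowedWord {a b : Q.Arr} {l : List Q.Arr}
    (hl : AllowedWord rel (b :: l)) (h : ¬ AllowedWord rel (a :: b :: l)) :
    arr k Q rel a * wordEl k Q rel (b :: l) = 0 := by
  rw [wordEl_cons, ← mul_assoc, arr_mul_arr_of_not_follows, zero_mul]
  exact fun hf => h (List.isChain_cons_cons.2 ⟨hf, hl⟩)

variable (k rel) in
/-- `A` is spanned by the stationary paths and the paths of positive length. -/
theorem span_basisPaths : Submodule.span k (Set.range (vtx k Q rel) ∪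
    wordEl k Q rel '' {l | l ≠ [] ∧ AllowedWord rel l}) = ⊤ := by
  set W := Submodule.span k (Set.range (vtx k Q rel) ∪
    wordEl k Q rel '' {l | l ≠ [] ∧ AllowedWord rel l})
  have hv : ∀ v, vtx k Q rel v ∈ W := fun v => Submodule.subset_span (Or.inl ⟨v, rfl⟩)
  have hw : ∀ l, l ≠ [] → AllowedWord rel l → wordEl k Q rel l ∈ W := fun l h1 h2 =>
    Submodule.subset_span (Or.inr ⟨l, ⟨h1, h2⟩, rfl⟩)
  have hgen : ∀ g : GA k Q rel, (∀ v, g * vtx k Q rel v ∈ W) →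
      (∀ l, l ≠ [] → AllowedWord rel l → g * wordEl k Q rel l ∈ W) → ∀ w ∈ W, g * w ∈ W := by
    intro g h1 h2 w hwW
    induction hwW using Submodule.span_induction with
    | mem x hx =>
      rcases hx with ⟨v, rfl⟩ | ⟨l, hl, rfl⟩
      · exact h1 v
      · exact h2 l hl.1 hl.2
    | zero => simp
    | add x y _ _ hx hy => simpa [mul_add] using W.add_mem hx hy
    | smul c x _ hx => simpa using W.smul_mem c hx
  have hstab : ∀ x : GA k Q rel, ∀ w ∈ W, x * w ∈ W := by
    intro x
    induction x using GA.induction with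
    | hs c =>
      intro w hwW
      rw [← Algebra.smul_def]
      exact W.smul_mem c hwW
    | hv v =>
      refine hgen _ (fun v' => ?_) fun l hl hal => ?_
      · by_cases h : v = v'
        · rw [h, vtx_mul_vtx_self]
          exact hv v'
        · rw [vtx_mul_vtx_of_ne h]
          exact W.zero_mem
      · obtain ⟨a, l, rfl⟩ := List.exists_cons_of_ne_nil hl
        by_cases h : v = Q.src a
        · rw [h, vtx_mul_wordEl_cons]
          exact hw _ hl hal
        · rw [wordEl_cons, ← mul_assoc, vtx_mul_arr_of_ne h, zero_mul]
          exact W.zero_mem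
    | ha a =>
      refine hgen _ (fun v => ?_) fun l hl hal => ?_
      · by_cases h : v = Q.tgt a
        · rw [h, arr_mul_vtx]
          simpa [wordEl] using hw [a] (by simp) (by simp [allowedWord_iff])
        · rw [arr_mul_vtx_of_ne h]
          exact W.zero_mem
      · obtain ⟨b, l, rfl⟩ := List.exists_cons_of_ne_nil hl
        by_cases h : AllowedWord rel (a :: b :: l)
        · rw [← wordEl_cons]
          exact hw _ (by simp) h
        · rw [arr_mul_wordEl_cons_of_not_allowedWord hal h]
          exact W.zero_mem
    | hadd x y hx hy =>
      intro w hwW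
      rw [add_mul]
      exact W.add_mem (hx w hwW) (hy w hwW)
    | hmul x y hx hy =>
      intro w hwW
      rw [mul_assoc]
      exact hx _ (hy w hwW)
  rw [eq_top_iff]
  intro x _
  have h1 : (1 : GA k Q rel) ∈ W := by
    rw [← sum_vtx]
    exact W.sum_mem fun v _ => hv v
  simpa using hstab x 1 h1

/-- Without infinite maximal paths `A` is finite dimensional. -/
theorem finite_of_not_exists_primCycleSq (h : ¬ ∃ c : List Q.Arr, PrimCycleSq rel c) :
    Module.Finite k (GA k Q rel) := by
  rw [Module.finite_def, ← span_basisPaths k rel]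
  refine Submodule.fg_span ((Set.finite_range _).union (Set.Finite.image _ ?_))
  exact (List.finite_length_le Q.Arr (Fintype.card Q.Arr)).subset
    fun l hl => length_le_card_of_allowedWord h l hl.2

/-- Two paths in `A` with the same first arrow and the same length agree. -/
theorem eq_of_allowedWord (hg : IsGentleRel Q rel) (a : Q.Arr) (l l' : List Q.Arr)
    (hl : AllowedWord rel (a :: l)) (hl' : AllowedWord rel (a :: l')) (h : l.length = l'.length) :
    l = l' := by
  induction l generalizing a l' with
  | nil => exact (List.length_eq_zero_iff.1 (by simpa using h.symm)).symm
  | cons b l ih =>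
    cases l' with
    | nil => simp at h
    | cons b' l' =>
      have h1 := List.isChain_cons_cons.1 ((allowedWord_iff _).1 hl)
      have h2 := List.isChain_cons_cons.1 ((allowedWord_iff _).1 hl')
      obtain rfl := Follows.right_unique hg a b b' h1.1 h2.1
      rw [ih b l' h1.2 h2.2 (by simpa using h)]

theorem Pth.el_of_w_eq_nil {p : Pth Q} (h : p.w = []) : p.el k rel = vtx k Q rel p.s := by
  simp [Pth.el, h, wordEl_nil]

theorem Pth.el_of_w_ne_nil {p : Pth Q} (h : p.w ≠ []) : p.el k rel = wordEl k Q rel p.w := by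
  obtain ⟨a, l, hal⟩ := List.exists_cons_of_ne_nil h
  rw [Pth.el, hal, ← p.hs a (by simp [hal]), vtx_mul_wordEl_cons]

theorem wordEl_mem_deg {l : List Q.Arr} (hl : l ≠ []) (h : AllowedWord rel l) :
    wordEl k Q rel l ∈ deg k Q rel l.length := by
  refine Submodule.subset_span ⟨⟨Q.src (l.head hl), l, fun a ha => ?_, ?_⟩, h, rfl, ?_⟩
  · rw [List.head?_eq_some_head hl] at ha
    simp only [Option.mem_some_iff] at ha
    rw [ha]
  · exact List.IsChain.imp (fun _ _ hab => hab.1) h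
  · exact (Pth.el_of_w_ne_nil (p := ⟨_, l, _, _⟩) hl).symm

/-- `A_{≤ n}` is spanned by stationary paths and the paths determined by a first arrow and a
length. -/
theorem exists_le_span (hg : IsGentleRel Q rel) (n : ℕ) :
    ∃ g : Q.V ⊕ Q.Arr × Fin n → GA k Q rel,
      (⨆ i ∈ Finset.range (n + 1), deg k Q rel i) ≤ Submodule.span k (Set.range g) := by
  classical
  let f : Q.Arr × Fin n → GA k Q rel := fun x =>
    if h : ∃ l, AllowedWord rel (x.1 :: l) ∧ l.length = x.2 then
      wordEl k Q rel (x.1 :: h.choose) else 0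
  let g : Q.V ⊕ Q.Arr × Fin n → GA k Q rel := Sum.elim (vtx k Q rel) f
  refine ⟨g, iSup₂_le fun i hi => Submodule.span_le.2 ?_⟩
  rintro _ ⟨p, hp, hpl, rfl⟩
  apply Submodule.subset_span
  rcases hw : p.w with _ | ⟨a, l⟩
  · exact ⟨Sum.inl p.s, (Pth.el_of_w_eq_nil hw).symm⟩
  · have hal : AllowedWord rel (a :: l) := hw ▸ hp
    have hlen : l.length < n := by
      have : p.len = l.length + 1 := by simp [Pth.len, hw]
      have := Finset.mem_range.1 hi
      omega
    refine ⟨Sum.inr (a, ⟨l.length, hlen⟩), ?_⟩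
    have hex : ∃ l', AllowedWord rel (a :: l') ∧ l'.length = l.length := ⟨l, hal, rfl⟩
    have h' := hex.choose_spec
    rw [Pth.el_of_w_ne_nil (by simp [hw]), hw]
    simp only [g, f, Sum.elim_inr]
    rw [dif_pos hex, ← eq_of_allowedWord hg a _ _ hal h'.1 h'.2.symm]

theorem finiteDimensional_le (hg : IsGentleRel Q rel) (n : ℕ) :
    FiniteDimensional k ↥(⨆ i ∈ Finset.range (n + 1), deg k Q rel i) := by
  obtain ⟨g, hle⟩ := exists_le_span (k := k) hg n
  have : FiniteDimensional k (Submodule.span k (Set.range g)) :=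
    FiniteDimensional.span_of_finite k (Set.finite_range g)
  exact Submodule.finiteDimensional_of_le hle

/-- Linear upper bound for the dimensions of `A_{≤ n}`. -/
theorem finrank_le (hg : IsGentleRel Q rel) (n : ℕ) :
    Module.finrank k ↥(⨆ i ∈ Finset.range (n + 1), deg k Q rel i) ≤
      Fintype.card Q.V + Fintype.card Q.Arr * n := by
  obtain ⟨g, hle⟩ := exists_le_span (k := k) hg n
  calc _ ≤ Module.finrank k (Submodule.span k (Set.range g)) := by
        have : FiniteDimensional k (Submodule.span k (Set.range g)) :=
          FiniteDimensional.span_of_finite k (Set.finite_range g)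
        exact Submodule.finrank_mono hle
    _ ≤ Fintype.card (Q.V ⊕ Q.Arr × Fin n) := finrank_range_le_card g
    _ = _ := by simp

variable (k rel) in
/-- A functional recording the length of paths. -/
def lengthFun : GA k Q rel →ₗ[k] Polynomial k where
  toFun x := ∑ i, ∑ t : Q.V, rep k rel (id : Q.V → Q.V) x i (Sum.inr t)
  map_add' x y := by simp [Finset.sum_add_distrib]
  map_smul' c x := by simp [Finset.smul_sum]

theorem lengthFun_wordEl {l : List Q.Arr} (hl : l ≠ []) (h : AllowedWord rel l) :
    lengthFun k rel (wordEl k Q rel l) = Polynomial.X ^ l.length := by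
  classical
  obtain ⟨a, l, rfl⟩ := List.exists_cons_of_ne_nil hl
  have key : ∀ i (t : Q.V), rep k rel (id : Q.V → Q.V) (wordEl k Q rel (a :: l)) i (Sum.inr t) =
      if i = Sum.inl a ∧ Q.tgt ((a :: l).getLast (by simp)) = t then
        Polynomial.X ^ (l.length + 1) else 0 := fun i t => by
    rw [rep_wordEl k rel id l a h i (Sum.inr t)]
    exact if_congr Iff.rfl rfl rfl
  change ∑ i, ∑ t : Q.V, rep k rel (id : Q.V → Q.V) (wordEl k Q rel (a :: l)) i (Sum.inr t) = _
  simp only [key, ite_and]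
  simp

theorem wordEl_ne_zero {l : List Q.Arr} (hl : l ≠ []) (h : AllowedWord rel l) :
    wordEl k Q rel l ≠ 0 := by
  intro h0
  have := lengthFun_wordEl (k := k) hl h
  rw [h0, map_zero] at this
  exact pow_ne_zero _ Polynomial.X_ne_zero this.symm

/-- Linear lower bound for the dimensions of `A_{≤ n}` if there are infinite maximal paths. -/
theorem le_finrank (hg : IsGentleRel Q rel) (hc : ∃ c : List Q.Arr, PrimCycleSq rel c) (n : ℕ) :
    n ≤ Module.finrank k ↥(⨆ i ∈ Finset.range (n + 1), deg k Q rel i) := by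
  choose l hl hlen using exists_allowedWord_length hc
  have hne : ∀ m, l (m + 1) ≠ [] := fun m h => by
    have := hlen (m + 1)
    simp [h] at this
  let u : Fin n → ↥(⨆ i ∈ Finset.range (n + 1), deg k Q rel i) := fun m =>
    ⟨wordEl k Q rel (l (m + 1)), by
      refine Submodule.mem_iSup_of_mem (m + 1 : ℕ) (Submodule.mem_iSup_of_mem ?_ ?_)
      · simp
      · have := wordEl_mem_deg (k := k) (hne m) (hl (m + 1))
        rwa [hlen] at this⟩
  have hu : LinearIndependent k u := by
    refine LinearIndependent.of_comp ((lengthFun k rel) ∘ₗ Submodule.subtype _) ?_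
    have : ⇑((lengthFun k rel) ∘ₗ Submodule.subtype _) ∘ u =
        Polynomial.basisMonomials k ∘ fun m : Fin n => (m : ℕ) + 1 := by
      ext1 m
      simp [u, lengthFun_wordEl (hne m) (hl (m + 1)), hlen, ← Polynomial.X_pow_eq_monomial]
    rw [this]
    exact (Polynomial.basisMonomials k).linearIndependent.comp _
      fun x y hxy => Fin.ext (by simpa using hxy)
  have := finiteDimensional_le (k := k) hg n
  simpa using hu.fintype_card_le_finrank

end Span

section GK

open Filter

variable {k : Type} [Field k] {Q : Quiv} {rel : Q.Arr → Q.Arr → Prop}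

theorem GKdim_eq_one (hg : IsGentleRel Q rel) (hc : ∃ c : List Q.Arr, PrimCycleSq rel c) :
    GKdim k Q rel = 1 := by
  apply Tendsto.limsup_eq
  set C : ℝ := Fintype.card Q.V + Fintype.card Q.Arr
  have hC : 0 < C := by
    have : 0 < Fintype.card Q.V := Fintype.card_pos
    positivity
  have hlog : Tendsto (fun n : ℕ => Real.log (n : ℝ)) atTop atTop :=
    Real.tendsto_log_atTop.comp tendsto_natCast_atTop_atTop
  have hup : Tendsto (fun n : ℕ => 1 + Real.log C / Real.log n) atTop (nhds 1) := by
    simpa using tendsto_const_nhds.add (hlog.const_div_atTop (Real.log C))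
  refine tendsto_of_tendsto_of_tendsto_of_le_of_le' tendsto_const_nhds hup ?_ ?_
  all_goals
    filter_upwards [eventually_ge_atTop 2] with n hn
    have hn1 : (1 : ℝ) < n := by exact_mod_cast hn
    have hpos : 0 < Real.log n := Real.log_pos hn1
    have hlow : (n : ℝ) ≤ Module.finrank k ↥(⨆ i ∈ Finset.range (n + 1), deg k Q rel i) := by
      exact_mod_cast le_finrank hg hc n
  · rw [le_div_iff₀ hpos, one_mul]
    exact Real.log_le_log (by linarith) hlow
  · rw [div_le_iff₀ hpos, add_mul, div_mul_cancel₀ _ hpos.ne', one_mul, add_comm (Real.log _),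
      ← Real.log_mul hC.ne' (by linarith)]
    refine Real.log_le_log (by linarith) ?_
    have := finrank_le (k := k) hg n
    calc (Module.finrank k ↥(⨆ i ∈ Finset.range (n + 1), deg k Q rel i) : ℝ) ≤
        Fintype.card Q.V + Fintype.card Q.Arr * n := by exact_mod_cast this
      _ ≤ _ := by
        rw [add_mul]
        gcongr
        exact le_mul_of_one_le_right (by positivity) hn1.le

theorem GKdim_eq_zero [Module.Finite k (GA k Q rel)] : GKdim k Q rel = 0 := by
  apply Tendsto.limsup_eq
  have hlog : Tendsto (fun n : ℕ => Real.log (n : ℝ)) atTop atTop :=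
    Real.tendsto_log_atTop.comp tendsto_natCast_atTop_atTop
  refine tendsto_of_tendsto_of_tendsto_of_le_of_le' tendsto_const_nhds
    (hlog.const_div_atTop (Real.log (Module.finrank k (GA k Q rel) : ℝ))) ?_ ?_
  · exact Eventually.of_forall fun n =>
      div_nonneg (Real.log_natCast_nonneg _) (Real.log_natCast_nonneg _)
  · refine Eventually.of_forall fun n =>
      div_le_div_of_nonneg_right ?_ (Real.log_natCast_nonneg _)
    rcases Nat.eq_zero_or_pos
      (Module.finrank k ↥(⨆ i ∈ Finset.range (n + 1), deg k Q rel i)) with h0 | hpos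
    · rw [h0, Nat.cast_zero, Real.log_zero]
      exact Real.log_natCast_nonneg _
    · exact Real.log_le_log (by exact_mod_cast hpos) (by exact_mod_cast Submodule.finrank_le _)

end GK

section Depth

open MulOpposite

variable {k : Type} [Field k] {Q : Quiv} {rel : Q.Arr → Q.Arr → Prop}

theorem vtxHom_vtx (v w : Q.V) : vtxHom k Q rel v (vtx k Q rel w) = if w = v then 1 else 0 := by
  simp [vtxHom, vtx, RingQuot.mkAlgHom_def, vtxHomAux]

theorem vtxHom_arr (v : Q.V) (a : Q.Arr) : vtxHom k Q rel v (arr k Q rel a) = 0 := by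
  simp [vtxHom, arr, RingQuot.mkAlgHom_def, vtxHomAux]

theorem vtxHom_algebraMap (v : Q.V) (c : k) :
    vtxHom k Q rel v (algebraMap k (GA k Q rel) c) = c := by
  rw [← (RingQuot.mkAlgHom k (GARel k Q rel)).commutes c, RingQuot.mkAlgHom_def]
  refine (RingQuot.lift_mkRingHom_apply _ _ _).trans ?_
  exact (vtxHomAux k Q v).commutes c

/-- An element of a right module which is concentrated in one vertex and annihilated by all
arrows spans a copy of a simple module. -/
theorem op_smul_eq_of_socle {M : Type} [AddCommGroup M] [Module (GA k Q rel)ᵐᵒᵖ M] (z : M)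
    (v : Q.V) (hv : op (vtx k Q rel v) • z = z) (hw : ∀ w, w ≠ v → op (vtx k Q rel w) • z = 0)
    (ha : ∀ a, op (arr k Q rel a) • z = 0) (x : GA k Q rel) :
    op x • z = op (algebraMap k (GA k Q rel) (vtxHom k Q rel v x)) • z := by
  induction x using GA.induction with
  | hs c => rw [vtxHom_algebraMap]
  | hv w =>
    rw [vtxHom_vtx]
    split_ifs with h
    · simp [h, hv]
    · simp [hw w h]
  | ha a => simp [vtxHom_arr, ha]
  | hadd x y hx hy => rw [MulOpposite.op_add, add_smul, hx, hy, map_add, map_add, MulOpposite.op_add, add_smul]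
  | hmul x y hx hy =>
    rw [op_mul, mul_smul, hx, map_mul, map_mul, ← Algebra.commutes, op_mul, mul_smul, ← hy,
      ← mul_smul, ← mul_smul, ← op_mul, ← op_mul, Algebra.commutes]

/-- A nonzero element of a right module which is concentrated in one vertex and annihilated by
all arrows gives a nonzero morphism from `S`. -/
theorem exists_hom_ne_zero (M : ModuleCat.{0} (GA k Q rel)ᵐᵒᵖ) (z : M) (hz : z ≠ 0)
    (v : Q.V) (hv : op (vtx k Q rel v) • z = z) (hw : ∀ w, w ≠ v → op (vtx k Q rel w) • z = 0)
    (ha : ∀ a, op (arr k Q rel a) • z = 0) : ∃ f : SModR k Q rel ⟶ M, f ≠ 0 := by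
  let _ : Module (GA k Q rel)ᵐᵒᵖ (Q.V → k) :=
    Module.compHom _ ((SHom k Q rel).fromOpposite (fun _ _ => mul_comm _ _))
  let f : (Q.V → k) →ₗ[(GA k Q rel)ᵐᵒᵖ] M :=
    { toFun := fun c => op (algebraMap k (GA k Q rel) (c v)) • z
      map_add' := fun c d => by simp [add_smul]
      map_smul' := fun r c => by
        have h1 : (r • c) v = vtxHom k Q rel v (unop r) * c v := rfl
        rw [h1, RingHom.id_apply, map_mul, op_mul, mul_smul, ← mul_smul r]
        rw [← op_smul_eq_of_socle z v hv hw ha, op_unop, ← mul_smul]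
        congr 1
        apply unop_injective
        simp [Algebra.commutes] }
  refine ⟨ModuleCat.ofHom f, fun h0 => hz ?_⟩
  have h1 : f (fun _ => 1) = 0 := by
    have := congrArg (fun g : SModR k Q rel ⟶ M => g.hom (fun _ => 1 : Q.V → k)) h0
    exact this
  simpa [f] using h1

/-- Every element of `S` is annihilated by all arrows. -/
theorem op_arr_smul_SModR (a : Q.Arr) (c : SModR k Q rel) : op (arr k Q rel a) • c = 0 := by
  funext v
  have : (op (arr k Q rel a) • c) v = vtxHom k Q rel v (arr k Q rel a) * c v := rfl
  exact this.trans (by rw [vtxHom_arr, zero_mul]; rfl)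

theorem wordEl_append_singleton_mul_vtx (l : List Q.Arr) (a : Q.Arr) :
    wordEl k Q rel (l ++ [a]) * vtx k Q rel (Q.tgt a) = wordEl k Q rel (l ++ [a]) := by
  rw [wordEl_append, mul_assoc, wordEl_cons, mul_assoc, wordEl_nil, one_mul, arr_mul_vtx, mul_one]

theorem wordEl_append_singleton_mul_vtx_of_ne (l : List Q.Arr) {a : Q.Arr} {v : Q.V}
    (h : v ≠ Q.tgt a) : wordEl k Q rel (l ++ [a]) * vtx k Q rel v = 0 := by
  rw [wordEl_append, mul_assoc, wordEl_cons, mul_assoc, wordEl_nil, one_mul, arr_mul_vtx_of_ne h,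
    mul_zero]

theorem wordEl_mul_arr_of_rightMaxWord {l : List Q.Arr} (h : RightMaxWord rel l) (b : Q.Arr) :
    wordEl k Q rel l * arr k Q rel b = 0 := by
  rcases l.eq_nil_or_concat' with rfl | ⟨l, a, rfl⟩
  · exact absurd rfl h.1
  · rw [wordEl_append, mul_assoc, wordEl_cons, wordEl_nil, mul_one, arr_mul_arr_of_not_follows,
      mul_zero]
    intro hab
    refine h.2.2 b ?_
    rw [allowedWord_iff, List.isChain_append]
    exact ⟨h.2.1, by simp, by simpa using hab⟩

theorem arr_mul_wordEl_of_leftMaxWord {l : List Q.Arr} (h : LeftMaxWord rel l) (b : Q.Arr) :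
    arr k Q rel b * wordEl k Q rel l = 0 := by
  obtain ⟨a, l, rfl⟩ := List.exists_cons_of_ne_nil h.1
  exact arr_mul_wordEl_cons_of_not_allowedWord h.2.1 (h.2.2 b)

theorem depth_eq_zero (h : ∃ l : List Q.Arr, FiniteMaxWord rel l) : depth k Q rel = 0 := by
  obtain ⟨l, hl, -⟩ := h
  have hz := wordEl_ne_zero (k := k) hl.1 hl.2.1
  have hexists : ∃ f : SModR k Q rel ⟶ AModR k Q rel, f ≠ 0 := by
    have harr := wordEl_mul_arr_of_rightMaxWord (k := k) hl
    rcases l.eq_nil_or_concat' with rfl | ⟨l, a, rfl⟩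
    · exact absurd rfl hl.1
    · exact exists_hom_ne_zero (AModR k Q rel) (wordEl k Q rel (l ++ [a]) : GA k Q rel) hz (Q.tgt a)
        (wordEl_append_singleton_mul_vtx l a)
        (fun w hw => wordEl_append_singleton_mul_vtx_of_ne l hw) harr
  obtain ⟨f, hf⟩ := hexists
  refine le_antisymm (sInf_le ⟨0, by simp, extNZ_zero_of_hom f hf⟩) bot_le

theorem depth_eq_one (h0 : ¬ extSNZ k Q rel 0) (h1 : extSNZ k Q rel 1) : depth k Q rel = 1 := by
  refine le_antisymm (sInf_le ⟨1, by simp, h1⟩) (le_sInf ?_)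
  rintro _ ⟨i, rfl, hi⟩
  rcases Nat.eq_zero_or_pos i with rfl | hpos
  · exact absurd hi h0
  · exact_mod_cast hpos

end Depth

section Periodic

variable {k : Type} [Field k] {Q : Quiv} {rel : Q.Arr → Q.Arr → Prop} {σ : Equiv.Perm Q.Arr}

variable (k rel σ) in
/-- The path of length `m` starting with `a`, when `σ` gives the unique continuation of every
arrow. -/
def pw : ℕ → Q.Arr → GA k Q rel
  | 0, a => vtx k Q rel (Q.src a)
  | m + 1, a => arr k Q rel a * pw m (σ a)

variable (k rel σ) in
/-- The sum of all paths of length `N > 0`. -/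
def pwSum (N : ℕ) : GA k Q rel := ∑ a, pw k rel σ N a

theorem pw_succ (m : ℕ) (a : Q.Arr) :
    pw k rel σ (m + 1) a = arr k Q rel a * pw k rel σ m (σ a) := rfl

theorem vtx_mul_pw (m : ℕ) (a : Q.Arr) :
    vtx k Q rel (Q.src a) * pw k rel σ m a = pw k rel σ m a := by
  cases m with
  | zero => exact vtx_mul_vtx_self _
  | succ m => rw [pw, ← mul_assoc, vtx_mul_arr]

theorem pw_mul_pw (n m : ℕ) (a : Q.Arr) :
    pw k rel σ n a * pw k rel σ m ((σ ^ n) a) = pw k rel σ (n + m) a := by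
  induction n generalizing a with
  | zero =>
    rw [pow_zero, Equiv.Perm.one_apply, zero_add]
    exact vtx_mul_pw m a
  | succ n ih =>
    rw [pw, mul_assoc, pow_succ, Equiv.Perm.mul_apply, ih, Nat.succ_add, pw]

theorem pw_mul_vtx (m : ℕ) (a : Q.Arr) :
    pw k rel σ m a * vtx k Q rel (Q.src ((σ ^ m) a)) = pw k rel σ m a :=
  pw_mul_pw m 0 a

theorem pw_mul_vtx_of_ne {m : ℕ} {a : Q.Arr} {v : Q.V} (h : v ≠ Q.src ((σ ^ m) a)) :
    pw k rel σ m a * vtx k Q rel v = 0 := by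
  rw [← pw_mul_vtx, mul_assoc, vtx_mul_vtx_of_ne h.symm, mul_zero]

variable (hσ : ∀ a b, Follows rel a b ↔ b = σ a)
include hσ

theorem tgt_eq_src (a : Q.Arr) : Q.tgt a = Q.src (σ a) := ((hσ a (σ a)).2 rfl).1

theorem pw_one (a : Q.Arr) : pw k rel σ 1 a = arr k Q rel a := by
  rw [pw, pw, ← tgt_eq_src hσ, arr_mul_vtx]

theorem pw_mul_arr (m : ℕ) (a : Q.Arr) :
    pw k rel σ m a * arr k Q rel ((σ ^ m) a) = pw k rel σ (m + 1) a := by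
  rw [← pw_one hσ, pw_mul_pw]

theorem pw_succ_mul_arr_of_ne {m : ℕ} {a b : Q.Arr} (h : b ≠ (σ ^ (m + 1)) a) :
    pw k rel σ (m + 1) a * arr k Q rel b = 0 := by
  induction m generalizing a with
  | zero =>
    rw [pw_one hσ, arr_mul_arr_of_not_follows]
    simpa [hσ] using h
  | succ m ih =>
    rw [pw, mul_assoc, ih, mul_zero]
    rwa [← Equiv.Perm.mul_apply, ← pow_succ]

theorem pwSum_mul_pw {N : ℕ} (hN : 0 < N) (hσN : σ ^ N = 1) (m : ℕ) (b : Q.Arr) :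
    pwSum k rel σ N * pw k rel σ (m + 1) b = pw k rel σ (N + (m + 1)) b := by
  rw [pwSum, Finset.sum_mul, Finset.sum_eq_single b]
  · have := pw_mul_pw (k := k) (rel := rel) (σ := σ) N (m + 1) b
    rwa [hσN, Equiv.Perm.one_apply] at this
  · intro a _ hab
    obtain ⟨n, rfl⟩ := Nat.exists_eq_add_one_of_ne_zero hN.ne'
    rw [pw_succ m, ← mul_assoc, pw_succ_mul_arr_of_ne hσ, zero_mul]
    rw [hσN]
    exact hab.symm
  · simp

theorem wordEl_eq_pw (l : List Q.Arr) (a : Q.Arr) (h : AllowedWord rel (a :: l)) :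
    wordEl k Q rel (a :: l) = pw k rel σ (l.length + 1) a := by
  induction l generalizing a with
  | nil => rw [wordEl_cons, wordEl_nil, mul_one, List.length_nil, pw_one hσ]
  | cons b l ih =>
    have hc := List.isChain_cons_cons.1 ((allowedWord_iff _).1 h)
    rw [wordEl_cons, ih b hc.2, (hσ a b).1 hc.1, List.length_cons, pw_succ (l.length + 1)]

theorem exists_allowedWord_cons (m : ℕ) (a : Q.Arr) : ∃ l : List Q.Arr,
    AllowedWord rel (a :: l) ∧ l.length = m := by
  induction m generalizing a with
  | zero => exact ⟨[], by simp [allowedWord_iff], rfl⟩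
  | succ m ih =>
    obtain ⟨l, hl, rfl⟩ := ih (σ a)
    exact ⟨σ a :: l, (allowedWord_iff _).2 (List.isChain_cons_cons.2 ⟨(hσ _ _).2 rfl, hl⟩), rfl⟩

theorem pwSum_mem_deg {N : ℕ} (hN : 0 < N) : pwSum k rel σ N ∈ deg k Q rel N := by
  rw [pwSum]
  refine Submodule.sum_mem _ fun a _ => ?_
  obtain ⟨n, rfl⟩ := Nat.exists_eq_add_one_of_ne_zero hN.ne'
  obtain ⟨l, hl, rfl⟩ := exists_allowedWord_cons hσ n a
  have h := wordEl_mem_deg (k := k) (List.cons_ne_nil a l) hl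
  rwa [wordEl_eq_pw hσ l a hl, List.length_cons] at h

theorem span_vtx_pw : Submodule.span k (Set.range (vtx k Q rel) ∪
    Set.range fun p : ℕ × Q.Arr => pw k rel σ (p.1 + 1) p.2) = ⊤ := by
  rw [eq_top_iff, ← span_basisPaths k rel]
  refine Submodule.span_mono (Set.union_subset_union_right _ ?_)
  rintro _ ⟨l, ⟨hl, hal⟩, rfl⟩
  obtain ⟨a, l, rfl⟩ := List.exists_cons_of_ne_nil hl
  exact ⟨(l.length, a), (wordEl_eq_pw hσ l a hal).symm⟩

variable (k rel) in
omit hσ in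
/-- The action of `A` on arrows, with polynomial coefficients recording path length. -/
abbrev arrRep : GA k Q rel →ₐ[k] Matrix (Q.Arr ⊕ Empty) (Q.Arr ⊕ Empty) (Polynomial k) :=
  rep k rel Empty.elim

theorem arrRep_pw (m : ℕ) (a : Q.Arr) : arrRep k rel (pw k rel σ (m + 1) a) =
    Matrix.single (Sum.inl a) (Sum.inl ((σ ^ (m + 1)) a)) (Polynomial.X ^ (m + 1)) := by
  have harr (a : Q.Arr) : arrMat k rel Empty.elim a =
      Matrix.single (Sum.inl a) (Sum.inl (σ a)) Polynomial.X := by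
    ext1 i j
    rcases j with b | t
    · simp only [arrMat, Matrix.of_apply, NextState, Sum.elim_inl, hσ, Matrix.single_apply,
        eq_comm (a := i), Sum.inl.injEq, eq_comm (a := b)]
    · exact t.elim
  induction m generalizing a with
  | zero => rw [pw_one hσ, rep_arr, harr, zero_add, pow_one, pow_one]
  | succ m ih =>
    rw [pw, map_mul, rep_arr, harr, ih, Matrix.single_mul_single_same, ← pow_succ',
      pow_succ σ (m + 1), Equiv.Perm.mul_apply]

theorem arrRep_pwSum {N : ℕ} (hN : 0 < N) (hσN : σ ^ N = 1) :
    arrRep k rel (pwSum k rel σ N) = algebraMap (Polynomial k) _ (Polynomial.X ^ N) := by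
  obtain ⟨n, rfl⟩ := Nat.exists_eq_add_one_of_ne_zero hN.ne'
  rw [pwSum, map_sum]
  simp only [arrRep_pw hσ, hσN, Equiv.Perm.one_apply]
  ext1 i j
  rw [Matrix.sum_apply, Matrix.algebraMap_matrix_apply]
  rcases i with a | t
  · rw [Finset.sum_eq_single a]
    · simp [Matrix.single_apply]
    · intro b _ hb
      simp [hb]
    · simp
  · exact t.elim

omit hσ in
theorem exists_src_eq (hσ : ∀ a b, Follows rel a b ↔ b = σ a) (v : Q.V) : ∃ a, Q.src a = v := by
  rcases subsingleton_or_nontrivial Q.V with h | h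
  · exact ⟨Classical.arbitrary _, Subsingleton.elim _ _⟩
  · obtain ⟨w, hw⟩ := Q.connected.preconnected.exists_adj_of_nontrivial v
    rw [SimpleGraph.fromRel_adj] at hw
    rcases hw.2 with ⟨a, ha, -⟩ | ⟨a, -, ha⟩
    · exact ⟨a, ha⟩
    · exact ⟨σ a, by rw [← ha, tgt_eq_src hσ]⟩

theorem arrRep_injective : Function.Injective (arrRep k rel) := by
  choose s hs using exists_src_eq hσ
  let P (a : Q.Arr) : Polynomial k →ₗ[k] GA k Q rel :=
    (Polynomial.basisMonomials k).constr k fun m => if m = 0 then 0 else pw k rel σ m a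
  have hP (a : Q.Arr) (m : ℕ) : P a (Polynomial.X ^ m) = if m = 0 then 0 else pw k rel σ m a := by
    have h := (Polynomial.basisMonomials k).constr_basis k
      (fun m => if m = 0 then 0 else pw k rel σ m a) m
    rw [Polynomial.coe_basisMonomials] at h
    rwa [← Polynomial.monomial_one_right_eq_X_pow]
  let L (M : Matrix (Q.Arr ⊕ Empty) (Q.Arr ⊕ Empty) (Polynomial k)) : GA k Q rel :=
    ∑ v, (M (Sum.inl (s v)) (Sum.inl (s v))).coeff 0 • vtx k Q rel v +
      ∑ a, P a (∑ j, M (Sum.inl a) j)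
  let L' : GA k Q rel →ₗ[k] GA k Q rel :=
    { toFun := fun y => L (arrRep k rel y)
      map_add' := fun y z => by
        simp only [L, map_add, Matrix.add_apply, Polynomial.coeff_add, add_smul,
          Finset.sum_add_distrib]
        abel
      map_smul' := fun c y => by
        simp only [L, map_smul, Matrix.smul_apply, Polynomial.coeff_smul, smul_assoc,
          ← Finset.smul_sum, ← smul_add, RingHom.id_apply] }
  have hL : L' = LinearMap.id := by
    refine LinearMap.ext_on (span_vtx_pw hσ) ?_
    rintro _ (⟨v, rfl⟩ | ⟨⟨m, a⟩, rfl⟩)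
    · have h1 (a : Q.Arr) : P a (∑ j, vtxMat k Empty.elim v (Sum.inl a) j) = 0 := by
        have h0 : P a 1 = 0 := by simpa using hP a 0
        rw [Finset.sum_eq_single (Sum.inl a)]
        · rw [vtxMat, Matrix.diagonal_apply_eq]
          split_ifs
          · exact h0
          · exact map_zero _
        · intro j _ hj
          exact Matrix.diagonal_apply_ne _ hj.symm
        · simp
      change L (arrRep k rel (vtx k Q rel v)) = _
      simp only [L, rep_vtx, h1, Finset.sum_const_zero, add_zero]
      rw [Finset.sum_eq_single v]
      · simp [vtxMat, stateVtx, hs]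
      · intro w _ hw
        simp [vtxMat, stateVtx, hs, hw]
      · simp
    · change L (arrRep k rel (pw k rel σ (m + 1) a)) = _
      simp only [L, arrRep_pw hσ]
      rw [Finset.sum_eq_zero, zero_add, Finset.sum_eq_single a]
      · rw [Finset.sum_eq_single (Sum.inl ((σ ^ (m + 1)) a))]
        · rw [Matrix.single_apply_same, hP, if_neg m.succ_ne_zero]
          rfl
        · intro j _ hj
          simp [hj.symm]
        · simp
      · intro b _ hb
        simp [hb.symm]
      · simp
      · intro v _
        rw [Matrix.single_apply]
        split_ifs <;> simp
  refine Function.LeftInverse.injective (g := L) fun y => ?_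
  exact LinearMap.congr_fun hL y

variable {N : ℕ} (hN : 0 < N) (hσN : σ ^ N = 1)
include hN hσN

theorem arrRep_aeval_pwSum (p : Polynomial k) :
    arrRep k rel (Polynomial.aeval (pwSum k rel σ N) p) =
      algebraMap (Polynomial k) _ (Polynomial.expand k N p) := by
  rw [← Polynomial.aeval_algHom_apply, arrRep_pwSum hσ hN hσN, Polynomial.aeval_algebraMap_apply,
    Polynomial.expand_eq_comp_X_pow, Polynomial.comp_eq_aeval]

/-- Nonzero polynomials in `pwSum` act regularly. -/
theorem eq_zero_or_eq_zero_of_aeval_pwSum_mul (p : Polynomial k) (y : GA k Q rel)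
    (h : Polynomial.aeval (pwSum k rel σ N) p * y = 0) : p = 0 ∨ y = 0 := by
  have h1 := congrArg (arrRep k rel) h
  rw [map_mul, arrRep_aeval_pwSum hσ hN hσN, map_zero, ← Algebra.smul_def, smul_eq_zero] at h1
  refine h1.imp (fun h => ?_) fun h => ?_
  · exact (Polynomial.expand_eq_zero hN).1 h
  · exact arrRep_injective hσ (h.trans (map_zero _).symm)

theorem aeval_pwSum_injective : Function.Injective (Polynomial.aeval (R := k) (pwSum k rel σ N)) := by
  rw [injective_iff_map_eq_zero]
  intro p hp
  refine (eq_zero_or_eq_zero_of_aeval_pwSum_mul hσ hN hσN p 1 (by rw [hp, zero_mul])).resolve_right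
    fun h1 => ?_
  obtain ⟨a⟩ := Q.nonemptyA
  refine wordEl_ne_zero (k := k) (rel := rel) (l := [a]) (by simp) (by simp [allowedWord_iff]) ?_
  rw [← mul_one (wordEl k Q rel [a]), h1, mul_zero]

theorem eq_zero_of_forall_mul_arr_eq_zero {y : GA k Q rel} (h : ∀ a, y * arr k Q rel a = 0) : y = 0 := by
  have h1 : y * pwSum k rel σ N = 0 := by
    rw [pwSum, Finset.mul_sum]
    refine Finset.sum_eq_zero fun a _ => ?_
    obtain ⟨n, rfl⟩ := Nat.exists_eq_add_one_of_ne_zero hN.ne'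
    rw [pw, ← mul_assoc, h, zero_mul]
  have h2 := congrArg (arrRep k rel) h1
  rw [map_mul, arrRep_pwSum hσ hN hσN, map_zero, ← Algebra.commutes, ← Algebra.smul_def,
    smul_eq_zero] at h2
  rcases h2 with h2 | h2
  · exact absurd h2 (pow_ne_zero _ Polynomial.X_ne_zero)
  · exact arrRep_injective hσ (h2.trans (map_zero _).symm)

theorem not_extSNZ_zero : ¬ extSNZ k Q rel 0 := by
  refine not_extNZ_zero fun f => ?_
  ext c
  refine eq_zero_of_forall_mul_arr_eq_zero hσ hN hσN fun a => ?_
  have h1 := f.hom.map_smul (MulOpposite.op (arr k Q rel a)) c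
  rw [op_arr_smul_SModR, map_zero] at h1
  exact h1.symm

omit hN in
theorem extSNZ_one (hN : 2 ≤ N) : extSNZ k Q rel 1 := by
  have hN0 : 0 < N := by omega
  set x := pwSum k rel σ N with hx
  let F : GA k Q rel →ₗ[(GA k Q rel)ᵐᵒᵖ] GA k Q rel :=
    { toFun := fun y => x * y
      map_add' := mul_add x
      map_smul' := fun r y => (mul_assoc x y r.unop).symm }
  have hF (y : GA k Q rel) : F y = x * y := rfl
  have hFinj : Function.Injective F := by
    rw [injective_iff_map_eq_zero]
    intro y hy
    refine (eq_zero_or_eq_zero_of_aeval_pwSum_mul hσ hN0 hσN Polynomial.X y ?_).resolve_left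
      Polynomial.X_ne_zero
    rwa [Polynomial.aeval_X]
  obtain ⟨a⟩ := Q.nonemptyA
  have h1 : pw k rel σ (0 + 1) a ∉ LinearMap.range F := by
    rintro ⟨y, hy⟩
    have h2 := congrArg (arrRep k rel) hy
    rw [hF, map_mul, arrRep_pwSum hσ hN0 hσN, ← Algebra.smul_def, arrRep_pw hσ] at h2
    have h3 := congrFun (congrFun h2 (Sum.inl a)) (Sum.inl ((σ ^ (0 + 1)) a))
    rw [Matrix.single_apply_same, Matrix.smul_apply, smul_eq_mul, zero_add] at h3
    have h4 := Dvd.intro _ h3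
    rw [pow_dvd_pow_iff Polynomial.X_ne_zero Polynomial.not_isUnit_X] at h4
    omega
  have h2 : pw k rel σ (N + 1) a ∈ LinearMap.range F :=
    ⟨pw k rel σ (0 + 1) a, pwSum_mul_pw hσ hN0 hσN 0 a⟩
  obtain ⟨m, hm, hm'⟩ : ∃ m, pw k rel σ (m + 1) a ∉ LinearMap.range F ∧
      pw k rel σ (m + 1 + 1) a ∈ LinearMap.range F := by
    by_contra! hc
    exact (Nat.rec h1 hc : ∀ n, pw k rel σ (n + 1) a ∉ LinearMap.range F) N h2
  let z : GA k Q rel ⧸ LinearMap.range F := Submodule.Quotient.mk (pw k rel σ (m + 1) a)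
  have hz (y : GA k Q rel) : MulOpposite.op y • z =
      Submodule.Quotient.mk (pw k rel σ (m + 1) a * y) := rfl
  obtain ⟨f, hf⟩ := exists_hom_ne_zero (ModuleCat.of _ (GA k Q rel ⧸ LinearMap.range F)) z
    (fun h => hm ((Submodule.Quotient.mk_eq_zero _).1 h)) (Q.src ((σ ^ (m + 1)) a))
    (by rw [hz, pw_mul_vtx]) (fun w hw => by rw [hz, pw_mul_vtx_of_ne hw, Submodule.Quotient.mk_zero])
    (fun b => by
      rw [hz]
      by_cases hb : b = (σ ^ (m + 1)) a
      · rw [hb, pw_mul_arr hσ]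
        exact (Submodule.Quotient.mk_eq_zero _).2 hm'
      · rw [pw_succ_mul_arr_of_ne hσ hb, Submodule.Quotient.mk_zero])
  let φ : AModR k Q rel ⟶ AModR k Q rel := ModuleCat.ofHom F
  let π : AModR k Q rel ⟶ ModuleCat.of _ (GA k Q rel ⧸ LinearMap.range F) :=
    ModuleCat.ofHom (LinearMap.range F).mkQ
  have : Mono φ := (ModuleCat.mono_iff_injective φ).2 hFinj
  have : Epi π := (ModuleCat.epi_iff_surjective π).2 (Submodule.mkQ_surjective _)
  have hw : φ ≫ π = 0 := ModuleCat.hom_ext <| LinearMap.ext fun y =>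
    (Submodule.Quotient.mk_eq_zero _).2 ⟨y, rfl⟩
  refine extNZ_one (fun g => ?_) φ π hw ?_ f hf
  · by_contra hg
    exact not_extSNZ_zero hσ hN0 hσN (extNZ_zero_of_hom g hg)
  · rw [ShortComplex.moduleCat_exact_iff]
    intro y hy
    exact (Submodule.Quotient.mk_eq_zero _).1 hy

end Periodic

section CohenMacaulay

variable {k : Type} [Field k] {Q : Quiv} {rel : Q.Arr → Q.Arr → Prop}

/-- A finitely generated torsion-free module over a ring isomorphic to a principal ideal domain
is free. -/
theorem free_of_ringEquiv {S R A : Type*} [CommRing S] [IsDomain S] [IsPrincipalIdealRing S]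
    [Semiring R] [AddCommGroup A] [Module R A] [Module.Finite R A] (e : S ≃+* R)
    (h : ∀ (s : S) (y : A), e s • y = 0 → s = 0 ∨ y = 0) : Module.Free R A := by
  let _ : Module S A := Module.compHom A e.toRingHom
  have := RingHomInvPair.of_ringEquiv e
  have : RingHomInvPair (e.symm : R →+* S) (e : S →+* R) := .of_ringEquiv e.symm
  let f : A ≃ₛₗ[(e : S →+* R)] A :=
    { AddEquiv.refl A with map_smul' := fun _ _ => rfl }
  have : Module.Finite S A := Module.Finite.of_surjective f.symm.toLinearMap f.symm.surjective
  have : Module.IsTorsionFree S A := .of_smul_eq_zero h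
  exact Module.Free.of_equiv f

theorem satCM2_of_finite [Module.Finite k (GA k Q rel)] [Nontrivial (GA k Q rel)] :
    SatCM2 k Q rel := by
  refine ⟨0, Fin.elim0, by simpa using GKdim_eq_zero, fun i => i.elim0, fun i => i.elim0, ?_, ?_⟩
  · rw [linearIndependent_unique_iff]
    simp
  · have hfin : Module.Finite ↥(Algebra.adjoin k (Set.range (Fin.elim0 : Fin 0 → GA k Q rel)))
        (GA k Q rel) := Module.Finite.of_restrictScalars_finite k _ _
    refine ⟨?_, hfin⟩
    have hbot : Algebra.adjoin k (Set.range (Fin.elim0 : Fin 0 → GA k Q rel)) = ⊥ := by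
      rw [Set.range_eq_empty, Algebra.adjoin_empty]
    let e := (Algebra.botEquivOfInjective (algebraMap k (GA k Q rel)).injective).symm.trans
      (Subalgebra.equivOfEq _ _ hbot.symm)
    refine free_of_ringEquiv e.toRingEquiv fun s y h => ?_
    have h1 : e s • y = s • y := by
      rw [← mul_one s, ← smul_eq_mul, map_smul, map_one, smul_assoc, one_smul, smul_eq_mul, mul_one]
    exact smul_eq_zero.1 (h1.symm.trans h)

theorem range_fin_one {α : Type*} (x : Fin 1 → α) : Set.range x = {x 0} := by
  rw [Set.range_unique]
  rfl

/-- Evaluation identifies the polynomial ring with the subalgebra generated by a transcendental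
element. -/
theorem exists_ringEquiv_adjoin {A : Type*} [Ring A] [Algebra k A] (x : Fin 1 → A)
    (h : Function.Injective (Polynomial.aeval (R := k) (x 0))) :
    ∃ e : Polynomial k ≃+* ↥(Algebra.adjoin k (Set.range x)),
      ∀ p, (e p : A) = Polynomial.aeval (x 0) p := by
  have h1 : (Polynomial.aeval (R := k) (x 0)).range = Algebra.adjoin k (Set.range x) := by
    rw [range_fin_one, Algebra.adjoin_singleton_eq_range_aeval]
  exact ⟨((AlgEquiv.ofInjective _ h).trans (Subalgebra.equivOfEq _ _ h1)).toRingEquiv,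
    fun p => rfl⟩

theorem linearIndependent_fin_one_iff {A : Type*} [Ring A] [Algebra k A] (x : Fin 1 → A) :
    LinearIndependent k
        (fun m : Fin 1 →₀ ℕ => ((List.finRange 1).map fun i => x i ^ m i).prod) ↔
      Function.Injective (Polynomial.aeval (R := k) (x 0)) := by
  have h1 : (fun m : Fin 1 →₀ ℕ => ((List.finRange 1).map fun i => x i ^ m i).prod) =
      (fun n : ℕ => x 0 ^ n) ∘ (Finsupp.uniqueEquiv (0 : Fin 1)) := by
    ext m
    simp [List.finRange_succ]
  rw [h1, linearIndependent_equiv]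
  have h2 : (fun n : ℕ => x 0 ^ n) =
      (Polynomial.aeval (R := k) (x 0)).toLinearMap ∘ Polynomial.basisMonomials k := by
    ext n
    simp
  rw [h2]
  constructor
  · exact fun h => LinearMap.injective_of_linearIndependent (Polynomial.basisMonomials k).span_eq h
  · intro h
    exact (Polynomial.basisMonomials k).linearIndependent.map' _ (LinearMap.ker_eq_bot.2 h)

theorem satCM2_of_perm (hg : IsGentleRel Q rel) (hc : ∃ c : List Q.Arr, PrimCycleSq rel c)
    {σ : Equiv.Perm Q.Arr} (hσ : ∀ a b, Follows rel a b ↔ b = σ a) {N : ℕ} (hN : 0 < N)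
    (hσN : σ ^ N = 1) : SatCM2 k Q rel := by
  let x : Fin 1 → GA k Q rel := fun _ => pwSum k rel σ N
  have hinj : Function.Injective (Polynomial.aeval (R := k) (x 0)) :=
    aeval_pwSum_injective hσ hN hσN
  have hmem : x 0 ∈ Algebra.adjoin k (Set.range x) := Algebra.subset_adjoin ⟨0, rfl⟩
  obtain ⟨e, he⟩ := exists_ringEquiv_adjoin x hinj
  have hfin : Module.Finite ↥(Algebra.adjoin k (Set.range x)) (GA k Q rel) := by
    let T : Set (GA k Q rel) := Set.range (vtx k Q rel) ∪
      Set.range fun p : Fin N × Q.Arr => pw k rel σ (p.1 + 1) p.2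
    have hT : T.Finite := (Set.finite_range _).union (Set.finite_range _)
    refine ⟨⟨hT.toFinset, ?_⟩⟩
    rw [Set.Finite.coe_toFinset, ← Submodule.restrictScalars_eq_top_iff k, eq_top_iff,
      ← span_vtx_pw hσ, Submodule.span_le]
    rintro _ (⟨v, rfl⟩ | ⟨⟨m, a⟩, rfl⟩)
    · exact Submodule.subset_span (Or.inl ⟨v, rfl⟩)
    · change pw k rel σ (m + 1) a ∈ Submodule.span ↥(Algebra.adjoin k (Set.range x)) T
      induction m using Nat.strong_induction_on with
      | _ m ih =>
        rcases lt_or_ge m N with hm | hm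
        · exact Submodule.subset_span (Or.inr ⟨(⟨m, hm⟩, a), rfl⟩)
        · obtain ⟨n, rfl⟩ := Nat.exists_eq_add_of_le hm
          rw [add_assoc, ← pwSum_mul_pw hσ hN hσN]
          exact Submodule.smul_mem _ (⟨x 0, hmem⟩ : ↥(Algebra.adjoin k (Set.range x)))
            (ih n (by omega))
  refine ⟨1, x, by rw [GKdim_eq_one hg hc, Nat.cast_one], fun _ _ => Commute.refl _,
    fun _ => ⟨N, pwSum_mem_deg hσ hN⟩, (linearIndependent_fin_one_iff x).2 hinj,
    free_of_ringEquiv e fun p y h => ?_, hfin⟩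
  refine eq_zero_or_eq_zero_of_aeval_pwSum_mul hσ hN hσN p y ?_
  rw [← he p]
  exact h

/-- Left multiplication by any element maps a left maximal path to a scalar multiple of it. -/
theorem exists_mul_wordEl_of_leftMaxWord {l : List Q.Arr} (h : LeftMaxWord rel l)
    (x : GA k Q rel) : ∃ c : k, x * wordEl k Q rel l = c • wordEl k Q rel l := by
  induction x using GA.induction with
  | hs c => exact ⟨c, (Algebra.smul_def _ _).symm⟩
  | hv v =>
    obtain ⟨a, l, rfl⟩ := List.exists_cons_of_ne_nil h.1
    rw [wordEl_cons, ← mul_assoc]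
    by_cases hv : v = Q.src a
    · exact ⟨1, by rw [hv, vtx_mul_arr, one_smul]⟩
    · exact ⟨0, by rw [vtx_mul_arr_of_ne hv, zero_mul, zero_smul]⟩
  | ha a => exact ⟨0, by rw [arr_mul_wordEl_of_leftMaxWord h, zero_smul]⟩
  | hadd x y hx hy =>
    obtain ⟨c, hc⟩ := hx
    obtain ⟨d, hd⟩ := hy
    exact ⟨c + d, by rw [add_mul, hc, hd, add_smul]⟩
  | hmul x y hx hy =>
    obtain ⟨c, hc⟩ := hx
    obtain ⟨d, hd⟩ := hy
    exact ⟨d * c, by rw [mul_assoc, hd, mul_smul_comm, hc, mul_smul]⟩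

theorem not_satCM2 (hg : IsGentleRel Q rel) (hf : ∃ l : List Q.Arr, FiniteMaxWord rel l)
    (hc : ∃ c : List Q.Arr, PrimCycleSq rel c) : ¬ SatCM2 k Q rel := by
  rintro ⟨d, x, hd, -, -, hind, hfree, -⟩
  rw [GKdim_eq_one hg hc] at hd
  obtain rfl : d = 1 := by exact_mod_cast hd.symm
  rw [linearIndependent_fin_one_iff] at hind
  obtain ⟨e, he⟩ := exists_ringEquiv_adjoin x hind
  obtain ⟨l, hl, hl'⟩ := hf
  obtain ⟨c, hc⟩ := exists_mul_wordEl_of_leftMaxWord (k := k) hl' (x 0)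
  refine wordEl_ne_zero (k := k) hl.1 hl.2.1 ?_
  have h1 : e (Polynomial.X - Polynomial.C c) • wordEl k Q rel l = 0 := by
    change (e (Polynomial.X - Polynomial.C c) : GA k Q rel) * wordEl k Q rel l = 0
    rw [he, map_sub, Polynomial.aeval_X, Polynomial.aeval_C, sub_mul, hc, Algebra.smul_def, sub_self]
  let b := Module.Free.chooseBasis ↥(Algebra.adjoin k (Set.range x)) (GA k Q rel)
  have h2 := congrArg b.repr h1
  rw [map_smul, map_zero] at h2
  refine b.repr.map_eq_zero_iff.1 (Finsupp.ext fun i => ?_)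
  have h3 := DFunLike.congr_fun h2 i
  rw [Finsupp.smul_apply, smul_eq_mul, Finsupp.zero_apply, ← e.apply_symm_apply (b.repr _ i),
    ← map_mul, map_eq_zero_iff e e.injective, mul_eq_zero] at h3
  rcases h3 with h3 | h3
  · exact absurd h3 (Polynomial.X_sub_C_ne_zero c)
  · rw [← e.apply_symm_apply (b.repr _ i), h3, map_zero, Finsupp.zero_apply]

end CohenMacaulay

/-- **Theorem 6.6 (thm:CM).** For a (locally) gentle algebra `A = kQ/I` the following are
equivalent: (1) `A` satisfies (CM1), i.e. `GKdim A = depth A`; (2) `A` satisfies (CM2);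
(3) `A` has no finite maximal paths or `A` has no infinite maximal paths. -/
theorem statement19 (k : Type) [Field k] [CharZero k] (Q : Quiv)
    (rel : Q.Arr → Q.Arr → Prop) (hgentle : IsGentleRel Q rel) :
    (SatCM1 k Q rel ↔ SatCM2 k Q rel) ∧
    (SatCM2 k Q rel ↔
      ((¬ ∃ l : List Q.Arr, FiniteMaxWord rel l) ∨
       (¬ ∃ c : List Q.Arr, PrimCycleSq rel c))) := by
  suffices h : (SatCM1 k Q rel ∧ SatCM2 k Q rel ∧ ((¬ ∃ l : List Q.Arr, FiniteMaxWord rel l) ∨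
      (¬ ∃ c : List Q.Arr, PrimCycleSq rel c))) ∨
      (¬ SatCM1 k Q rel ∧ ¬ SatCM2 k Q rel ∧ ¬ ((¬ ∃ l : List Q.Arr, FiniteMaxWord rel l) ∨
      (¬ ∃ c : List Q.Arr, PrimCycleSq rel c))) by
    tauto
  by_cases hf : ∃ l : List Q.Arr, FiniteMaxWord rel l
  · by_cases hc : ∃ c : List Q.Arr, PrimCycleSq rel c
    · refine Or.inr ⟨?_, not_satCM2 hgentle hf hc, by tauto⟩
      rintro ⟨d, hd, hd'⟩
      rw [depth_eq_zero hf] at hd'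
      rw [GKdim_eq_one hgentle hc] at hd
      have h1 : d = 1 := by exact_mod_cast hd.symm
      have h0 : d = 0 := by exact_mod_cast hd'.symm
      omega
    · have := finite_of_not_exists_primCycleSq (k := k) hc
      have : Nontrivial (GA k Q rel) := by
        obtain ⟨l, hl, -⟩ := hf
        exact nontrivial_of_ne _ _ (wordEl_ne_zero hl.1 hl.2.1)
      exact Or.inl ⟨⟨0, by rw [GKdim_eq_zero, Nat.cast_zero], by rw [depth_eq_zero hf]; rfl⟩,
        satCM2_of_finite, Or.inr hc⟩
  · have hc := exists_primCycleSq hgentle hf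
    obtain ⟨σ, hσ⟩ := exists_perm hgentle hf
    have hN : 0 < 2 * orderOf σ := Nat.mul_pos two_pos (orderOf_pos σ)
    have hσN : σ ^ (2 * orderOf σ) = 1 := orderOf_dvd_iff_pow_eq_one.1 (Dvd.intro_left 2 rfl)
    refine Or.inl ⟨⟨1, by rw [GKdim_eq_one hgentle hc, Nat.cast_one], ?_⟩,
      satCM2_of_perm hgentle hc hσ hN hσN, Or.inl hf⟩
    exact depth_eq_one (not_extSNZ_zero hσ hN hσN) (extSNZ_one hσ hσN (by omega))

end LocGentle
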